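/- arXiv:2506.15119 — 10 statements merged into one kernel-verified Lean document; each statement's English description precedes it below -/
import Mathlib

section
/- Let α₀ > 0 and a ∈ ℝ, and let g : (a,∞) → ℂ be continuous with ‖g(t)‖ < 1 for all t > a. Then for every s > a there exist t₁, t₂ ∈ [s, s + 2π/α₀] such that Im( exp(i·α₀·t₁) · (1 + g(t₁)) ) = 0 and Im( exp(i·α₀·t₂) · (1 + g(t₂)) ) ≠ 0. In particular, the set { t > a : Im( exp(i·α₀·t) · (1 + g(t)) ) = 0 } is infinite. -/
open Complex Set

/-- Every interval of length `2π/ω` contains a time at which the phase `ω * t` is congruent to `θ`. -/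
theorem exists_mem_Icc_sin_cos_eq {ω : ℝ} (hω : 0 < ω) (s θ : ℝ) :
    ∃ t ∈ Set.Icc s (s + 2 * Real.pi / ω),
      Real.sin (ω * t) = Real.sin θ ∧ Real.cos (ω * t) = Real.cos θ := by
  obtain ⟨k, ⟨h₁, h₂⟩, -⟩ := existsUnique_add_zsmul_mem_Ico Real.two_pi_pos θ (ω * s)
  rw [zsmul_eq_mul] at h₁ h₂
  refine ⟨(θ + k * (2 * Real.pi)) / ω, ⟨?_, ?_⟩, ?_, ?_⟩
  · rw [le_div_iff₀ hω]
    linarith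
  · rw [div_le_iff₀ hω, add_mul, div_mul_cancel₀ _ hω.ne']
    linarith
  · rw [mul_div_cancel₀ _ hω.ne', Real.sin_add_int_mul_two_pi]
  · rw [mul_div_cancel₀ _ hω.ne', Real.cos_add_int_mul_two_pi]

theorem im_exp_I_mul_mul (ω t : ℝ) (z : ℂ) :
    (Complex.exp (Complex.I * ω * t) * z).im =
      Real.cos (ω * t) * z.im + Real.sin (ω * t) * z.re := by
  have h : Complex.I * ω * t = ((ω * t : ℝ) : ℂ) * Complex.I := by
    push_cast
    ring
  rw [h, Complex.mul_im, Complex.exp_ofReal_mul_I_re, Complex.exp_ofReal_mul_I_im]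

theorem one_add_re_pos_of_norm_lt_one {z : ℂ} (hz : ‖z‖ < 1) : 0 < (1 + z).re := by
  have := (abs_lt.mp ((Complex.abs_re_le_norm z).trans_lt hz)).1
  rw [Complex.add_re, Complex.one_re]
  linarith

/-- The curve `ε(t) = e^{iα₀t}(1 + g(t))` with `‖g‖ < 1` meets the real axis in every
interval of length `2π/α₀`, and also leaves it there; in particular the zero set of the
imaginary part is infinite. -/
theorem stmt_2 (α₀ : ℝ) (hα₀ : 0 < α₀) (a : ℝ) (g : ℝ → ℂ)
    (hg_cont : ContinuousOn g (Set.Ioi a)) (hg : ∀ t, a < t → ‖g t‖ < 1) :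
    (∀ s, a < s →
      ∃ t₁ ∈ Set.Icc s (s + 2 * Real.pi / α₀),
      ∃ t₂ ∈ Set.Icc s (s + 2 * Real.pi / α₀),
        (Complex.exp (Complex.I * α₀ * t₁) * (1 + g t₁)).im = 0 ∧
        (Complex.exp (Complex.I * α₀ * t₂) * (1 + g t₂)).im ≠ 0) ∧
    {t : ℝ | a < t ∧ (Complex.exp (Complex.I * α₀ * t) * (1 + g t)).im = 0}.Infinite := by
  have hzero : ∀ s, a < s →
      ∃ t₁ ∈ Set.Icc s (s + 2 * Real.pi / α₀),
      ∃ t₂ ∈ Set.Icc s (s + 2 * Real.pi / α₀),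
        (Complex.exp (Complex.I * α₀ * t₁) * (1 + g t₁)).im = 0 ∧
        (Complex.exp (Complex.I * α₀ * t₂) * (1 + g t₂)).im ≠ 0 := by
    intro s hs
    have hsub : Set.Icc s (s + 2 * Real.pi / α₀) ⊆ Set.Ioi a := fun t ht => hs.trans_le ht.1
    obtain ⟨u, hu, hsu, hcu⟩ := exists_mem_Icc_sin_cos_eq hα₀ s (Real.pi / 2)
    obtain ⟨v, hv, hsv, hcv⟩ := exists_mem_Icc_sin_cos_eq hα₀ s (-(Real.pi / 2))
    have hpos : 0 < (Complex.exp (Complex.I * α₀ * u) * (1 + g u)).im := by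
      rw [im_exp_I_mul_mul, hsu, hcu, Real.sin_pi_div_two, Real.cos_pi_div_two]
      linarith [one_add_re_pos_of_norm_lt_one (hg u (hsub hu))]
    have hneg : (Complex.exp (Complex.I * α₀ * v) * (1 + g v)).im < 0 := by
      rw [im_exp_I_mul_mul, hsv, hcv, Real.sin_neg, Real.cos_neg, Real.sin_pi_div_two,
        Real.cos_pi_div_two]
      linarith [one_add_re_pos_of_norm_lt_one (hg v (hsub hv))]
    have hcont : ContinuousOn
        (fun t : ℝ => (Complex.exp (Complex.I * α₀ * t) * (1 + g t)).im)
        (Set.Icc s (s + 2 * Real.pi / α₀)) := by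
      have hg_Icc := hg_cont.mono hsub
      exact Complex.continuous_im.comp_continuousOn (by fun_prop)
    obtain ⟨t, ht, ht_zero⟩ :=
      isPreconnected_Icc.intermediate_value hv hu hcont ⟨hneg.le, hpos.le⟩
    exact ⟨t, ht, u, hu, ht_zero, hpos.ne'⟩
  refine ⟨hzero, Set.infinite_of_not_bddAbove ?_⟩
  rintro ⟨b, hb⟩
  have has : a < max a b + 1 := (le_max_left a b).trans_lt (lt_add_one _)
  obtain ⟨t, ht, -, -, ht_zero, -⟩ := hzero _ has
  have htb : t ≤ b := hb ⟨has.trans_le ht.1, ht_zero⟩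
  linarith [ht.1, le_max_right a b]
end

section
/- Let ε ∈ (0, π/2) and let γ : (0,∞) → ℂ be a function such that ε < |arg γ(t)| < π − ε for all t > 0 and |Im γ(t)| → ∞ as t → ∞. Then |Im( (γ(t) − 1/2)·Log γ(t) − γ(t) )| → ∞ as t → ∞. -/
open Filter Complex

/-- The sine is at least `sin ε` on `[ε, π - ε]`. -/
lemma sin_le_sin_of_mem_Icc_pi_sub {ε x : ℝ} (hε : 0 ≤ ε) (h₁ : ε ≤ x)
    (h₂ : x ≤ Real.pi - ε) : Real.sin ε ≤ Real.sin x := by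
  rcases le_total x (Real.pi / 2) with h | h
  · exact Real.sin_le_sin_of_le_of_le_pi_div_two (by linarith) h h₁
  · rw [← Real.sin_pi_sub x]
    exact Real.sin_le_sin_of_le_of_le_pi_div_two (by linarith) (by linarith) (by linarith)

/-- In the sector `ε ≤ |arg z| ≤ π - ε`, the modulus is controlled by the imaginary part. -/
lemma norm_mul_sin_le_abs_im {ε : ℝ} (hε : 0 ≤ ε) {z : ℂ} (h₁ : ε ≤ |arg z|)
    (h₂ : |arg z| ≤ Real.pi - ε) : ‖z‖ * Real.sin ε ≤ |z.im| := by
  have h_sin : Real.sin ε ≤ |Real.sin (arg z)| := by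
    rw [Real.abs_sin_eq_sin_abs_of_abs_le_pi (abs_arg_le_pi z)]
    exact sin_le_sin_of_mem_Icc_pi_sub hε h₁ h₂
  calc ‖z‖ * Real.sin ε ≤ ‖z‖ * |Real.sin (arg z)| := by gcongr
    _ = |z.im| := by rw [← norm_mul_sin_arg z, abs_mul, abs_norm]

/-- A lower bound for the imaginary part of the main term of the Stirling exponent. -/
lemma le_abs_im_sub_half_mul_log_sub_self (z : ℂ) :
    |z.im| * (Real.log ‖z‖ - 1) - (‖z‖ + 1 / 2) * Real.pi ≤
      |((z - 1 / 2) * log z - z).im| := by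
  have h_im : ((z - 1 / 2) * log z - z).im =
      z.im * (Real.log ‖z‖ - 1) + (z.re - 1 / 2) * arg z := by
    simp [mul_im, log_re, log_im]
    ring
  have h_re : |z.re - 1 / 2| ≤ ‖z‖ + 1 / 2 := by
    have := abs_le.1 (abs_re_le_norm z)
    exact abs_le.2 ⟨by linarith, by linarith⟩
  have h_arg : |(z.re - 1 / 2) * arg z| ≤ (‖z‖ + 1 / 2) * Real.pi := by
    rw [abs_mul]
    gcongr
    exact abs_arg_le_pi z
  have h_main : |z.im| * (Real.log ‖z‖ - 1) ≤ |z.im * (Real.log ‖z‖ - 1)| := by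
    rw [abs_mul]
    gcongr
    exact le_abs_self _
  have h_add := abs_sub_abs_le_abs_sub (z.im * (Real.log ‖z‖ - 1)) (-((z.re - 1 / 2) * arg z))
  rw [abs_neg, sub_neg_eq_add] at h_add
  rw [h_im]
  linarith

/-- Along a curve in the sector `ε < |arg z| < π - ε` whose imaginary part is unbounded,
the imaginary part of the main term of the Stirling exponent tends to infinity. -/
theorem stmt_4 (ε : ℝ) (hε : ε ∈ Set.Ioo 0 (Real.pi / 2)) (γ : ℝ → ℂ)
    (hsector : ∀ t : ℝ, 0 < t →
      ε < |Complex.arg (γ t)| ∧ |Complex.arg (γ t)| < Real.pi - ε)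
    (him : Filter.Tendsto (fun t => |(γ t).im|) Filter.atTop Filter.atTop) :
    Filter.Tendsto
      (fun t => |((γ t - 1 / 2) * Complex.log (γ t) - γ t).im|)
      Filter.atTop Filter.atTop := by
  have h_sin : 0 < Real.sin ε :=
    Real.sin_pos_of_pos_of_lt_pi hε.1 (by linarith [hε.2, Real.pi_pos])
  have h_log := Real.tendsto_log_atTop.comp him
  refine tendsto_atTop_mono' _ ?_ (tendsto_atTop_add_const_right _ (-(Real.pi / 2)) him)
  filter_upwards [eventually_gt_atTop 0, him.eventually_gt_atTop 0,
    h_log.eventually_ge_atTop (2 + Real.pi / Real.sin ε)] with t ht h_pos h_large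
  obtain ⟨h₁, h₂⟩ := hsector t ht
  have h_norm : ‖γ t‖ ≤ |(γ t).im| / Real.sin ε :=
    (le_div_iff₀ h_sin).2 (norm_mul_sin_le_abs_im hε.1.le h₁.le h₂.le)
  have h_log_norm : 2 + Real.pi / Real.sin ε ≤ Real.log ‖γ t‖ :=
    h_large.trans (Real.log_le_log h_pos (abs_im_le_norm _))
  calc |(γ t).im| + -(Real.pi / 2)
      = |(γ t).im| * (2 + Real.pi / Real.sin ε - 1) -
          (|(γ t).im| / Real.sin ε + 1 / 2) * Real.pi := by ring
    _ ≤ |(γ t).im| * (Real.log ‖γ t‖ - 1) - (‖γ t‖ + 1 / 2) * Real.pi := by gcongr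
    _ ≤ _ := le_abs_im_sub_half_mul_log_sub_self _
end

section
/- Let ε ∈ (0, π/2) and let γ : (0,∞) → ℂ be a continuous function such that ε < |arg γ(t)| < π − ε for all t > 0 and |Im γ(t)| → ∞ as t → ∞. Then the set { t ∈ (0,∞) : Re( Γ(γ(t)) ) = 0 } is infinite. -/
open Filter Complex

/-- A continuous choice of the argument of `GammaSeq z n` on the upper half plane. -/
noncomputable def gammaSeqArg (z : ℂ) (n : ℕ) : ℝ :=
  z.im * Real.log n - ∑ k ∈ Finset.range (n + 1), (z + k).arg

/-- A continuous choice of the argument of `Γ z` on the upper half plane. -/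
noncomputable def gammaArg (z : ℂ) : ℝ :=
  -(Real.eulerMascheroniConstant * z.im) - z.arg
    + ∑' k : ℕ, (z.im / (k + 1 : ℕ) - (z + (k + 1 : ℕ)).arg)

lemma norm_mul_exp_gammaSeqArg (z : ℂ) {n : ℕ} (hn : n ≠ 0) :
    (‖GammaSeq z n‖ : ℂ) * exp (gammaSeqArg z n * I) = GammaSeq z n := by
  have hn' : (0 : ℝ) < n := by positivity
  have hprod : (∏ k ∈ Finset.range (n + 1), (z + k) : ℂ)
      = ‖∏ k ∈ Finset.range (n + 1), (z + k : ℂ)‖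
        * exp ((∑ k ∈ Finset.range (n + 1), (z + k).arg : ℝ) * I) := by
    rw [norm_prod, ofReal_prod, ofReal_sum, Finset.sum_mul, exp_sum, ← Finset.prod_mul_distrib]
    exact Finset.prod_congr rfl fun k _ => (norm_mul_exp_arg_mul_I _).symm
  have hpow : (n : ℂ) ^ z = ‖(n : ℂ) ^ z‖ * exp ((z.im * Real.log n : ℝ) * I) := by
    have h : ((n : ℝ) : ℂ) ^ z = ‖((n : ℝ) : ℂ) ^ z‖ * exp ((z.im * Real.log n : ℝ) * I) := by
      rw [norm_cpow_eq_rpow_re_of_pos hn', cpow_def_of_ne_zero (by exact_mod_cast hn),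
        ← ofReal_log hn'.le, Real.rpow_def_of_pos hn', ofReal_exp, ← exp_add]
      congr 1
      conv_lhs => rw [← re_add_im z]
      push_cast
      ring
    simpa using h
  rw [gammaSeqArg, ofReal_sub, sub_mul, exp_sub, GammaSeq, norm_div, norm_mul]
  conv_rhs => rw [hprod, hpow]
  simp only [norm_natCast, ofReal_div, ofReal_mul, ofReal_natCast]
  have := exp_ne_zero ((∑ k ∈ Finset.range (n + 1), (z + k).arg : ℝ) * I)
  rw [mul_comm (‖∏ k ∈ Finset.range (n + 1), (z + k : ℂ)‖ : ℂ), ← div_div]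
  ring

lemma abs_im_div_sub_arg_add_natCast_le {z : ℂ} {R : ℝ} (hz : ‖z‖ ≤ R) {k : ℕ} (hk : k ≠ 0) :
    |z.im / k - (z + k).arg| ≤ ((R + Real.pi) * (2 * R) ^ 2 + R ^ 2) * (1 / (k : ℝ) ^ 2) := by
  have hk' : (1 : ℝ) ≤ k := by exact_mod_cast Nat.one_le_iff_ne_zero.mpr hk
  have hR : 0 ≤ R := (norm_nonneg z).trans hz
  have hpi := Real.pi_pos
  rw [mul_one_div, le_div_iff₀ (by positivity)]
  rcases le_or_gt (k : ℝ) (2 * R) with h | h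
  · have h1 : |z.im / k - (z + k).arg| ≤ R + Real.pi := by
      refine (abs_sub _ _).trans (add_le_add ?_ (abs_arg_le_pi _))
      rw [abs_div, Nat.abs_cast]
      exact (div_le_self (abs_nonneg _) hk').trans ((abs_im_le_norm z).trans hz)
    have h2 : (k : ℝ) ^ 2 ≤ (2 * R) ^ 2 := by gcongr
    calc _ ≤ (R + Real.pi) * (2 * R) ^ 2 := by gcongr
      _ ≤ _ := by nlinarith [sq_nonneg R]
  · have hk0 : (k : ℂ) ≠ 0 := by exact_mod_cast hk
    have hw : ‖z / k‖ ≤ 1 / 2 := by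
      rw [norm_div, norm_natCast, div_le_iff₀ (by positivity)]
      linarith
    have harg : (z + k).arg = (log (1 + z / k)).im := by
      rw [log_im, ← arg_real_mul (1 + z / k) (r := k) (by positivity)]
      congr 1
      push_cast
      field_simp
      ring
    have him : z.im / k = (z / k).im := by simp
    rw [harg, him, abs_sub_comm, ← sub_im]
    have h1 : |(log (1 + z / k) - z / k).im| ≤ ‖z / k‖ ^ 2 := by
      refine (abs_im_le_norm _).trans
        ((norm_log_one_add_sub_self_le (hw.trans_lt (by norm_num))).trans ?_)
      have : (1 - ‖z / k‖)⁻¹ ≤ 2 := by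
        rw [inv_le_comm₀ (by linarith) (by norm_num)]
        linarith
      nlinarith [sq_nonneg ‖z / k‖]
    have h2 : ‖z / k‖ ^ 2 * (k : ℝ) ^ 2 = ‖z‖ ^ 2 := by
      rw [norm_div, norm_natCast]
      field_simp
    calc _ ≤ ‖z / k‖ ^ 2 * (k : ℝ) ^ 2 := by gcongr
      _ = ‖z‖ ^ 2 := h2
      _ ≤ R ^ 2 := by gcongr
      _ ≤ _ := by nlinarith [mul_nonneg (add_nonneg hR hpi.le) (sq_nonneg (2 * R))]

lemma summable_gammaArg_bound (c : ℝ) :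
    Summable fun k : ℕ => c * (1 / ((k + 1 : ℕ) : ℝ) ^ 2) :=
  ((summable_nat_add_iff 1).mpr (Real.summable_one_div_nat_pow.mpr one_lt_two)).mul_left c

lemma tendsto_gammaSeqArg (z : ℂ) :
    Tendsto (gammaSeqArg z) atTop (nhds (gammaArg z)) := by
  have hs : Summable fun k : ℕ => z.im / (k + 1 : ℕ) - (z + (k + 1 : ℕ)).arg :=
    .of_norm_bounded (summable_gammaArg_bound _) fun k =>
      abs_im_div_sub_arg_add_natCast_le le_rfl k.succ_ne_zero
  have h := ((Real.tendsto_harmonic_sub_log.mul_const z.im).neg.sub_const z.arg).add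
    hs.hasSum.tendsto_sum_nat
  refine h.congr fun n => ?_
  rw [gammaSeqArg, Finset.sum_range_succ', Finset.sum_sub_distrib, harmonic]
  simp only [div_eq_mul_inv, ← Finset.mul_sum]
  push_cast
  simp only [add_zero]
  ring

lemma norm_mul_exp_gammaArg (z : ℂ) :
    (‖Gamma z‖ : ℂ) * exp (gammaArg z * I) = Gamma z := by
  have h1 : Tendsto (fun n => (‖GammaSeq z n‖ : ℂ) * exp (gammaSeqArg z n * I)) atTop
      (nhds ((‖Gamma z‖ : ℂ) * exp (gammaArg z * I))) :=
    ((continuous_ofReal.tendsto _).comp (GammaSeq_tendsto_Gamma z).norm).mul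
      ((continuous_exp.tendsto _).comp
        (((continuous_ofReal.tendsto _).comp (tendsto_gammaSeqArg z)).mul_const I))
  refine tendsto_nhds_unique (h1.congr' ?_) (GammaSeq_tendsto_Gamma z)
  filter_upwards [eventually_ne_atTop 0] with n hn using norm_mul_exp_gammaSeqArg z hn

lemma re_Gamma_eq (z : ℂ) : (Gamma z).re = ‖Gamma z‖ * Real.cos (gammaArg z) := by
  conv_lhs => rw [← norm_mul_exp_gammaArg z, re_ofReal_mul, exp_ofReal_mul_I_re]

lemma continuousOn_gammaArg : ContinuousOn gammaArg {z | 0 < z.im} := by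
  have hslit : ∀ z ∈ {z : ℂ | 0 < z.im}, ∀ k : ℕ, ContinuousAt (fun w : ℂ => (w + k).arg) z := by
    intro z hz k
    have hmem : z + k ∈ slitPlane := mem_slitPlane_iff.mpr (.inr (by simpa using hz.ne'))
    exact (continuousAt_arg hmem).comp (f := fun w : ℂ => w + k) (by fun_prop)
  intro z hz
  refine ContinuousAt.continuousWithinAt (ContinuousAt.add (ContinuousAt.sub ?_ ?_) ?_)
  · exact (continuous_const.mul continuous_im).neg.continuousAt
  · simpa using hslit z hz 0
  · have hU : {w : ℂ | 0 < w.im} ∩ Metric.ball 0 (‖z‖ + 1) ∈ nhds z :=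
      inter_mem ((isOpen_lt continuous_const continuous_im).mem_nhds hz)
        (Metric.isOpen_ball.mem_nhds (by simp))
    refine ContinuousOn.continuousAt (continuousOn_tsum (fun k => ?_)
      (summable_gammaArg_bound _) fun k w hw =>
        abs_im_div_sub_arg_add_natCast_le (mem_ball_zero_iff.mp hw.2).le k.succ_ne_zero) hU
    intro w hw
    exact ((continuous_im.div_const _).continuousAt.sub (hslit w hw.1 (k + 1))).continuousWithinAt

lemma arg_le_im_div_re {w : ℂ} (hre : 0 < w.re) (him : 0 ≤ w.im) : w.arg ≤ w.im / w.re := by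
  rw [← tan_arg]
  exact Real.le_tan (arg_nonneg_iff.mpr him)
    ((le_abs_self _).trans_lt (abs_arg_lt_pi_div_two_iff.mpr (.inl hre)))

lemma sum_arg_add_natCast_le {z : ℂ} (him : 0 < z.im) {a : ℝ} (ha : -a ≤ z.re) {K n : ℕ}
    (hK : a + z.im ≤ K) (hn : K ≤ n) :
    ∑ k ∈ Finset.range (n + 1), (z + k).arg
      ≤ Real.pi * (K + 1) + z.im * (Real.log (n - a) - Real.log z.im) := by
  induction n, hn using Nat.le_induction with
  | base =>
    have h1 : ∑ k ∈ Finset.range (K + 1), (z + k).arg ≤ Real.pi * (K + 1) := by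
      refine (Finset.sum_le_card_nsmul _ _ Real.pi fun k _ => arg_le_pi _).trans_eq ?_
      simp [mul_comm]
    have h2 : Real.log z.im ≤ Real.log (K - a) := Real.log_le_log him (by linarith)
    nlinarith
  | succ n hn ih =>
    rw [Finset.sum_range_succ]
    have hn' : (K : ℝ) ≤ n := by exact_mod_cast hn
    have hpos : 0 < (n : ℝ) - a := by linarith
    have h1 : (z + (n + 1 : ℕ)).arg ≤ z.im * ((n + 1 : ℕ) - a)⁻¹ := by
      refine (arg_le_im_div_re ?_ ?_).trans ?_
      · simp only [add_re, natCast_re]; push_cast; linarith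
      · simpa using him.le
      · simp only [add_re, natCast_re, add_im, natCast_im, add_zero, div_eq_mul_inv]
        gcongr
        · push_cast; linarith
        · linarith
    have h2 : ((n + 1 : ℕ) - a : ℝ)⁻¹ ≤ Real.log ((n + 1 : ℕ) - a) - Real.log (n - a) := by
      have hpos' : 0 < ((n + 1 : ℕ) - a : ℝ) := by push_cast; linarith
      rw [← Real.log_div hpos'.ne' hpos.ne']
      refine le_trans (le_of_eq ?_) (Real.one_sub_inv_le_log_of_pos (by positivity))
      rw [inv_div]
      field_simp
      push_cast
      ring
    nlinarith [mul_le_mul_of_nonneg_left h2 him.le]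

lemma le_gammaArg {z : ℂ} (him : 0 < z.im) {C : ℝ} (hC : 0 ≤ C) (hre : -(C * z.im) ≤ z.re) :
    z.im * Real.log z.im - Real.pi * ((C + 1) * z.im + 2) ≤ gammaArg z := by
  refine ge_of_tendsto (tendsto_gammaSeqArg z) ?_
  have hK := Nat.le_ceil ((C + 1) * z.im)
  have hK' := (Nat.ceil_lt_add_one (a := (C + 1) * z.im) (by positivity)).le
  filter_upwards [eventually_ge_atTop ⌈(C + 1) * z.im⌉₊] with n hn
  have hn' : (⌈(C + 1) * z.im⌉₊ : ℝ) ≤ n := by exact_mod_cast hn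
  have h1 := sum_arg_add_natCast_le him hre (K := ⌈(C + 1) * z.im⌉₊) (by linarith) hn
  have h2 : Real.log (n - C * z.im) ≤ Real.log n :=
    Real.log_le_log (by linarith) (by nlinarith)
  rw [gammaSeqArg]
  nlinarith [mul_le_mul_of_nonneg_left h2 him.le, Real.pi_pos]

lemma infinite_re_Gamma_eq_zero_of_im_pos {C : ℝ} (hC : 0 ≤ C) {γ : ℝ → ℂ}
    (hcont : ContinuousOn γ (Set.Ioi 0)) (hpos : ∀ t, 0 < t → 0 < (γ t).im)
    (hre : ∀ t, 0 < t → -(C * (γ t).im) ≤ (γ t).re)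
    (him : Tendsto (fun t => (γ t).im) atTop atTop) :
    {t : ℝ | 0 < t ∧ (Gamma (γ t)).re = 0}.Infinite := by
  have hlim : Tendsto (fun t => gammaArg (γ t)) atTop atTop := by
    have h : Tendsto (fun y : ℝ => y * (Real.log y - Real.pi * (C + 1)) - Real.pi * 2)
        atTop atTop :=
      tendsto_atTop_add_const_right _ _
        (tendsto_id.atTop_mul_atTop₀ (tendsto_atTop_add_const_right _ _ Real.tendsto_log_atTop))
    refine tendsto_atTop_mono' _ ?_ (h.comp him)
    filter_upwards [eventually_gt_atTop 0] with t ht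
    refine le_trans (le_of_eq ?_) (le_gammaArg (hpos t ht) hC (hre t ht))
    simp only [Function.comp_apply]
    ring
  have hc : ContinuousOn (fun t => gammaArg (γ t)) (Set.Ici 1) :=
    continuousOn_gammaArg.comp (hcont.mono (Set.Ici_subset_Ioi.mpr one_pos))
      fun t ht => hpos t (one_pos.trans_le ht)
  have hsub := intermediate_value_Ici hc hlim
  have hpi := Real.pi_pos
  obtain ⟨m, hm⟩ := exists_nat_ge (gammaArg (γ 1) / Real.pi)
  rw [div_le_iff₀ hpi] at hm
  have hex : ∀ j : ℕ, ∃ t ∈ Set.Ici (1 : ℝ),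
      gammaArg (γ t) = Real.pi / 2 + (m + j : ℕ) * Real.pi := fun j =>
    hsub (by
      have : (0 : ℝ) ≤ j * Real.pi := by positivity
      rw [Set.mem_Ici]
      push_cast
      linarith)
  choose f hf1 hf2 using hex
  refine Set.infinite_of_injective_forall_mem (f := f) (fun i j hij => ?_) fun j => ?_
  · have h := (hf2 i).symm.trans ((congrArg (fun t => gammaArg (γ t)) hij).trans (hf2 j))
    have h' := mul_right_cancel₀ hpi.ne' (add_left_cancel h)
    have h'' : m + i = m + j := by exact_mod_cast h'
    omega
  · refine ⟨one_pos.trans_le (hf1 j), ?_⟩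
    rw [re_Gamma_eq, hf2, Real.cos_add_nat_mul_pi, Real.cos_pi_div_two, mul_zero, mul_zero]

lemma norm_mul_sin_lt_abs_im {ε : ℝ} (hε : ε ∈ Set.Ioo 0 (Real.pi / 2)) {z : ℂ}
    (h1 : ε < |z.arg|) (h2 : |z.arg| < Real.pi - ε) : ‖z‖ * Real.sin ε < |z.im| := by
  have hz : z ≠ 0 := by
    rintro rfl
    simp only [arg_zero, abs_zero] at h1
    exact h1.not_gt hε.1
  have hsin : Real.sin ε < Real.sin |z.arg| := by
    rcases le_or_gt |z.arg| (Real.pi / 2) with h | h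
    · exact Real.sin_lt_sin_of_lt_of_le_pi_div_two (by linarith [hε.1, Real.pi_pos]) h h1
    · rw [← Real.sin_pi_sub |z.arg|]
      exact Real.sin_lt_sin_of_lt_of_le_pi_div_two (by linarith [hε.1, Real.pi_pos])
        (by linarith) (by linarith)
  have habs : Real.sin |z.arg| ≤ |Real.sin z.arg| := by
    rcases abs_choice z.arg with h | h <;> rw [h]
    · exact le_abs_self _
    · rw [Real.sin_neg]; exact neg_le_abs _
  rw [← norm_mul_sin_arg z, abs_mul, abs_norm]
  exact mul_lt_mul_of_pos_left (hsin.trans_le habs) (norm_pos_iff.mpr hz)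

/-- Along a continuous curve in the sector `ε < |arg z| < π - ε` whose imaginary part is
unbounded, the real part of `Γ` vanishes infinitely often. -/
theorem stmt_5 (ε : ℝ) (hε : ε ∈ Set.Ioo 0 (Real.pi / 2)) (γ : ℝ → ℂ)
    (hcont : ContinuousOn γ (Set.Ioi 0))
    (hsector : ∀ t : ℝ, 0 < t →
      ε < |Complex.arg (γ t)| ∧ |Complex.arg (γ t)| < Real.pi - ε)
    (him : Filter.Tendsto (fun t => |(γ t).im|) Filter.atTop Filter.atTop) :
    {t : ℝ | 0 < t ∧ (Complex.Gamma (γ t)).re = 0}.Infinite := by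
  have hsin : 0 < Real.sin ε :=
    Real.sin_pos_of_pos_of_lt_pi hε.1 (by linarith [hε.2, Real.pi_pos])
  have him_gt : ∀ t, 0 < t → ‖γ t‖ * Real.sin ε < |(γ t).im| := fun t ht =>
    norm_mul_sin_lt_abs_im hε (hsector t ht).1 (hsector t ht).2
  have hne : ∀ t, 0 < t → (γ t).im ≠ 0 := fun t ht =>
    abs_pos.mp ((by positivity : 0 ≤ ‖γ t‖ * Real.sin ε).trans_lt (him_gt t ht))
  have hre : ∀ t, 0 < t → -((Real.sin ε)⁻¹ * |(γ t).im|) ≤ (γ t).re := by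
    intro t ht
    have h : ‖γ t‖ ≤ (Real.sin ε)⁻¹ * |(γ t).im| := by
      rw [inv_mul_eq_div, le_div_iff₀ hsin]
      exact (him_gt t ht).le
    linarith [neg_abs_le (γ t).re, abs_re_le_norm (γ t)]
  have hC : 0 ≤ (Real.sin ε)⁻¹ := by positivity
  have hcim : ContinuousOn (fun t => (γ t).im) (Set.Ioi 0) := continuous_im.comp_continuousOn hcont
  have hsign : (∀ t, 0 < t → 0 < (γ t).im) ∨ ∀ t, 0 < t → (γ t).im < 0 := by
    by_contra! h
    obtain ⟨⟨s, hs, hs'⟩, t, ht, ht'⟩ := h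
    obtain ⟨u, hu, hu'⟩ := isPreconnected_Ioi.intermediate_value hs ht hcim ⟨hs', ht'⟩
    exact hne u hu hu'
  rcases hsign with hpos | hneg
  · refine infinite_re_Gamma_eq_zero_of_im_pos hC hcont hpos (fun t ht => ?_) (him.congr' ?_)
    · simpa only [abs_of_pos (hpos t ht)] using hre t ht
    · filter_upwards [eventually_gt_atTop 0] with t ht using abs_of_pos (hpos t ht)
  · have h := infinite_re_Gamma_eq_zero_of_im_pos hC (γ := fun t => starRingEnd ℂ (γ t))
      (continuous_conj.comp_continuousOn hcont) (fun t ht => by simpa using hneg t ht)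
      (fun t ht => by simpa [abs_of_neg (hneg t ht)] using hre t ht) (him.congr' (by
        filter_upwards [eventually_gt_atTop 0] with t ht
        simpa using abs_of_neg (hneg t ht)))
    simpa only [Gamma_conj, conj_re] using h
end

section
/- For every θ ∈ (π/2, π) there exists M > 0 such that for all z ∈ ℂ with |arg z| ≤ θ and ‖z‖ > M, writing x = Re z and y = Im z: (√(2π)/e)·exp( (x − 1/2)·log‖z‖ − y·arg z − x ) ≤ ‖Γ(z)‖ ≤ e·√(2π)·exp( (x − 1/2)·log‖z‖ − y·arg z − x ). -/
open Complex Real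

open Filter Topology

/-- The leading exponent `(w - 1/2) log w - w` in Stirling's formula for `Γ(w)`. -/
noncomputable def stirlingExponent (w : ℂ) : ℂ := (w - 1 / 2) * Complex.log w - w

/-- The failure of `exp (stirlingExponent w)` to satisfy the functional equation of `Γ`, on the
level of logarithms of absolute values. -/
noncomputable def stirlingDefect (w : ℂ) : ℝ :=
  (stirlingExponent (w + 1)).re - (stirlingExponent w).re - Real.log ‖w‖

lemma stirlingExponent_re (z : ℂ) :
    (stirlingExponent z).re =
      (z.re - 1 / 2) * Real.log ‖z‖ - z.im * Complex.arg z - z.re := by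
  simp [stirlingExponent, Complex.log_re, Complex.log_im]

lemma log_add_one_eq_log_add {w : ℂ} (hw : 1 < ‖w‖) :
    Complex.log (w + 1) = Complex.log w + Complex.log (1 + w⁻¹) := by
  have hw0 : w ≠ 0 := norm_pos_iff.mp (by linarith)
  have hu : ‖w⁻¹‖ < 1 := by rw [norm_inv]; exact inv_lt_one_of_one_lt₀ hw
  have hre : 0 < (1 + w⁻¹).re := by
    have := (abs_le.mp (Complex.abs_re_le_norm w⁻¹)).1
    simp only [Complex.add_re, Complex.one_re]
    linarith
  have h1 : 1 + w⁻¹ ≠ 0 := fun h => by simp [h] at hre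
  have him : (1 + w⁻¹).im = -w.im / Complex.normSq w := by simp [Complex.inv_im]
  have hN : 0 < Complex.normSq w := Complex.normSq_pos.mpr hw0
  have habs : |Complex.arg (1 + w⁻¹)| < π / 2 := Complex.abs_arg_lt_pi_div_two_iff.mpr (Or.inl hre)
  obtain ⟨ha, hb⟩ := abs_lt.mp habs
  have hpi := Real.pi_pos
  rw [← Complex.log_mul hw0 h1, mul_add, mul_inv_cancel₀ hw0, mul_one]
  rcases le_or_gt 0 w.im with h | h
  · have h2 : Complex.arg (1 + w⁻¹) ≤ 0 := by
      by_contra! hlt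
      have h3 : 0 ≤ (1 + w⁻¹).im := Complex.arg_nonneg_iff.mp hlt.le
      have h4 : (1 + w⁻¹).im ≤ 0 := by
        rw [him]; exact div_nonpos_of_nonpos_of_nonneg (by linarith) hN.le
      have h5 : Complex.arg (1 + w⁻¹) = 0 :=
        Complex.arg_eq_zero_iff.mpr ⟨hre.le, le_antisymm h4 h3⟩
      linarith
    have h6 := Complex.arg_nonneg_iff.mpr h
    have h7 := Complex.arg_le_pi w
    constructor <;> linarith
  · have h2 : 0 ≤ Complex.arg (1 + w⁻¹) := by
      rw [Complex.arg_nonneg_iff, him]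
      exact div_nonneg (by linarith) hN.le
    have h6 := Complex.arg_neg_iff.mpr h
    have h7 := Complex.neg_pi_lt_arg w
    constructor <;> linarith

lemma abs_stirlingDefect_le {w : ℂ} (hw : 2 ≤ ‖w‖) : |stirlingDefect w| ≤ 2 / ‖w‖ ^ 2 := by
  have hw0 : w ≠ 0 := norm_pos_iff.mp (by linarith)
  have hlog : Real.log ‖w‖ = (Complex.log w).re := (Complex.log_re w).symm
  set u := w⁻¹ with hu
  have hun : ‖u‖ = ‖w‖⁻¹ := norm_inv w
  have hu2 : ‖u‖ ≤ 1 / 2 := by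
    rw [hun, one_div]; exact inv_anti₀ two_pos hw
  set R := Complex.log (1 + u) - (u - u ^ 2 / 2) with hR
  have hRle : ‖R‖ ≤ 2 / 3 * ‖u‖ ^ 3 := by
    have h := Complex.norm_log_sub_logTaylor_le 2 (z := u) (by linarith)
    have hT : Complex.logTaylor (2 + 1) u = u - u ^ 2 / 2 := by
      simp [Complex.logTaylor_succ, Complex.logTaylor_zero]; ring
    rw [hT] at h
    have h3 : (1 - ‖u‖)⁻¹ ≤ 2 := by
      rw [inv_le_comm₀ (by linarith) two_pos]; linarith
    calc ‖R‖ ≤ _ := h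
      _ ≤ ‖u‖ ^ 3 * 2 / 3 := by
        norm_num
        gcongr
      _ = _ := by ring
  have hwu : w * u = 1 := mul_inv_cancel₀ hw0
  have key : stirlingDefect w = (-(u ^ 2) / 4 + (w + 1 / 2) * R).re := by
    rw [stirlingDefect, hlog, ← Complex.sub_re, ← Complex.sub_re]
    congr 1
    rw [stirlingExponent, stirlingExponent, log_add_one_eq_log_add (by linarith), ← hu,
      show Complex.log (1 + u) = R + (u - u ^ 2 / 2) by rw [hR]; ring]
    linear_combination (1 - u / 2) * hwu
  have hwn : ‖w‖ * ‖u‖ = 1 := by rw [← norm_mul, hwu, norm_one]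
  have h2 : 2 / ‖w‖ ^ 2 = 2 * ‖u‖ ^ 2 := by rw [hun]; field_simp
  have h12 : ‖w + 1 / 2‖ ≤ ‖w‖ + 1 / 2 := by
    refine (norm_add_le _ _).trans ?_
    norm_num
  rw [key, h2]
  calc _ ≤ ‖-(u ^ 2) / 4 + (w + 1 / 2) * R‖ := Complex.abs_re_le_norm _
    _ ≤ ‖-(u ^ 2) / 4‖ + ‖(w + 1 / 2) * R‖ := norm_add_le _ _
    _ = ‖u‖ ^ 2 / 4 + ‖w + 1 / 2‖ * ‖R‖ := by simp
    _ ≤ ‖u‖ ^ 2 / 4 + (‖w‖ + 1 / 2) * (2 / 3 * ‖u‖ ^ 3) := by gcongr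
    _ = ‖u‖ ^ 2 / 4 + (‖w‖ * ‖u‖) * (2 / 3 * ‖u‖ ^ 2) + ‖u‖ / 3 * ‖u‖ ^ 2 := by ring
    _ ≤ ‖u‖ ^ 2 / 4 + 1 * (2 / 3 * ‖u‖ ^ 2) + (1 / 2) / 3 * ‖u‖ ^ 2 := by rw [hwn]; gcongr
    _ ≤ 2 * ‖u‖ ^ 2 := by nlinarith [sq_nonneg ‖u‖]

lemma norm_add_natCast_sq_ge {θ : ℝ} (hθ : θ ∈ Set.Ioo (π / 2) π) {z : ℂ}
    (hz : |Complex.arg z| ≤ θ) (k : ℕ) :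
    (1 + Real.cos θ) * (‖z‖ ^ 2 + (k : ℝ) ^ 2) ≤ ‖z + k‖ ^ 2 := by
  have hcos : Real.cos θ ≤ Real.cos (Complex.arg z) := by
    rw [← Real.cos_abs (Complex.arg z)]
    exact Real.cos_le_cos_of_nonneg_of_le_pi (abs_nonneg _) hθ.2.le hz
  have hneg : Real.cos θ ≤ 0 :=
    Real.cos_nonpos_of_pi_div_two_le_of_le hθ.1.le (by linarith [hθ.2, Real.pi_pos])
  have hre : ‖z‖ * Real.cos (Complex.arg z) = z.re := Complex.norm_mul_cos_arg z
  have hk : (0 : ℝ) ≤ k := k.cast_nonneg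
  have hmul : ‖z‖ * Real.cos θ ≤ z.re := by
    rw [← hre]; gcongr
  have hexp : ‖z + k‖ ^ 2 = ‖z‖ ^ 2 + 2 * z.re * k + (k : ℝ) ^ 2 := by
    rw [Complex.sq_norm, Complex.sq_norm, Complex.normSq_apply, Complex.normSq_apply]
    simp; ring
  rw [hexp]
  nlinarith [mul_le_mul_of_nonneg_right hmul hk,
    mul_nonneg (neg_nonneg.mpr hneg) (sq_nonneg (‖z‖ - k))]

lemma sum_inv_sq_add_sq_le {r : ℝ} (hr : 1 < r) (N : ℕ) :
    ∑ k ∈ Finset.range N, 1 / (r ^ 2 + (k : ℝ) ^ 2) ≤ 2 / (r - 1) := by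
  have key : ∀ k : ℕ, 1 / (r ^ 2 + (k : ℝ) ^ 2) ≤
      2 / (r - 1 + k) - 2 / (r - 1 + (k + 1 : ℕ)) := fun k => by
    have hk : (0 : ℝ) ≤ k := k.cast_nonneg
    have h1 : 0 < r - 1 + k := by linarith
    have h2 : 0 < r - 1 + (k + 1 : ℕ) := by push_cast; linarith
    rw [div_sub_div _ _ h1.ne' h2.ne', div_le_div_iff₀ (by positivity) (by positivity)]
    push_cast
    nlinarith [sq_nonneg (r - k)]
  calc _ ≤ ∑ k ∈ Finset.range N, (2 / (r - 1 + k) - 2 / (r - 1 + (k + 1 : ℕ))) :=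
        Finset.sum_le_sum fun k _ => key k
    _ = 2 / (r - 1) - 2 / (r - 1 + N) := by
        rw [Finset.sum_range_sub' (fun k : ℕ => 2 / (r - 1 + (k : ℝ)))]; simp
    _ ≤ _ := sub_le_self _ (div_nonneg zero_le_two (by have := N.cast_nonneg (α := ℝ); linarith))

lemma abs_sum_stirlingDefect_le_one {θ : ℝ} (hθ : θ ∈ Set.Ioo (π / 2) π) {z : ℂ}
    (hz : |Complex.arg z| ≤ θ) (hM : 1 + 4 / (1 + Real.cos θ) < ‖z‖) (N : ℕ) :
    |∑ k ∈ Finset.range N, stirlingDefect (z + k)| ≤ 1 := by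
  have hc : 0 < 1 + Real.cos θ := by
    have := Real.cos_lt_cos_of_nonneg_of_le_pi (by linarith [hθ.1, Real.pi_pos]) le_rfl hθ.2
    rw [Real.cos_pi] at this
    linarith
  set c := 1 + Real.cos θ
  have hz1 : 1 < ‖z‖ := lt_trans (lt_add_of_pos_right 1 (by positivity)) hM
  have hcz : 4 < c * (‖z‖ - 1) := by
    rw [mul_comm, ← div_lt_iff₀ hc]; linarith
  have hlow := norm_add_natCast_sq_ge hθ hz
  have hterm : ∀ k : ℕ, |stirlingDefect (z + k)| ≤ 2 / c * (1 / (‖z‖ ^ 2 + (k : ℝ) ^ 2)) :=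
    fun k => by
    have h2 : 2 ≤ ‖z + k‖ := by
      refine (sq_le_sq₀ zero_le_two (norm_nonneg _)).mp ?_
      refine le_trans ?_ (hlow k)
      nlinarith [mul_nonneg hc.le (sq_nonneg (k : ℝ)), mul_pos hc (by linarith : 0 < ‖z‖)]
    refine (abs_stirlingDefect_le h2).trans ?_
    rw [div_mul_div_comm, mul_one]
    gcongr
    exact hlow k
  calc _ ≤ ∑ k ∈ Finset.range N, |stirlingDefect (z + k)| := Finset.abs_sum_le_sum_abs _ _
    _ ≤ ∑ k ∈ Finset.range N, 2 / c * (1 / (‖z‖ ^ 2 + (k : ℝ) ^ 2)) :=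
        Finset.sum_le_sum fun k _ => hterm k
    _ ≤ 2 / c * (2 / (‖z‖ - 1)) := by
        rw [← Finset.mul_sum]
        gcongr
        exact sum_inv_sq_add_sq_le hz1 N
    _ ≤ 1 := by
        rw [div_mul_div_comm, div_le_one (mul_pos hc (by linarith))]
        linarith

lemma prod_norm_add_natCast_eq_exp {z : ℂ} (hz : ∀ k : ℕ, z + k ≠ 0) (N : ℕ) :
    ∏ k ∈ Finset.range N, ‖z + k‖ =
      Real.exp ((stirlingExponent (z + N)).re - (stirlingExponent z).re
        - ∑ k ∈ Finset.range N, stirlingDefect (z + k)) := by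
  induction N with
  | zero => simp
  | succ N ih =>
    rw [Finset.prod_range_succ, ih, Finset.sum_range_succ]
    nth_rewrite 1 [← Real.exp_log (norm_pos_iff.mpr (hz N))]
    rw [← Real.exp_add, stirlingDefect]
    push_cast
    rw [add_assoc z]
    congr 1
    ring

lemma tendsto_sub_stirlingExponent_re (z : ℂ) :
    Tendsto (fun n : ℕ => z.re * Real.log n + 1 / 2 * Real.log n + n * Real.log n - n
      - (stirlingExponent (z + (n + 1 : ℕ))).re) atTop (𝓝 0) := by
  have hone : Tendsto (fun n : ℕ => 1 + (z + 1) / (n : ℂ)) atTop (𝓝 1) := by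
    simpa using (tendsto_const_div_atTop_nhds_zero_nat (z + 1)).const_add 1
  have hmul : Tendsto (fun n : ℕ => (n : ℂ) * Complex.log (1 + (z + 1) / n)) atTop
      (𝓝 (z + 1)) := by
    refine Complex.tendsto_nat_mul_log_one_add_of_tendsto ?_
    refine tendsto_const_nhds.congr' ?_
    filter_upwards [eventually_ne_atTop 0] with n hn
    have : (n : ℂ) ≠ 0 := Nat.cast_ne_zero.mpr hn
    field_simp
  have hlog : Tendsto (fun n : ℕ => Complex.log (1 + (z + 1) / n)) atTop (𝓝 0) := by
    simpa using hone.clog Complex.one_mem_slitPlane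
  have hlim : Tendsto (fun n : ℕ => ((z + 1) - ((n : ℂ) * Complex.log (1 + (z + 1) / n)
      + (z + 1 / 2) * Complex.log (1 + (z + 1) / n))).re) atTop (𝓝 0) := by
    have h := (hmul.add (hlog.const_mul (z + 1 / 2))).const_sub (z + 1)
    rw [mul_zero, add_zero, sub_self] at h
    exact (Complex.continuous_re.tendsto 0).comp h
  refine hlim.congr' ?_
  have hne : ∀ᶠ n : ℕ in atTop, 1 + (z + 1) / (n : ℂ) ≠ 0 :=
    hone.eventually_ne one_ne_zero
  filter_upwards [hne, eventually_gt_atTop 0] with n h1 hn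
  have hn0 : (n : ℂ) ≠ 0 := Nat.cast_ne_zero.mpr hn.ne'
  have hnr : (0 : ℝ) < n := Nat.cast_pos.mpr hn
  have hsplit : Complex.log (z + (n + 1 : ℕ)) =
      (Real.log n : ℝ) + Complex.log (1 + (z + 1) / n) := by
    rw [← Complex.log_ofReal_mul hnr h1]
    congr 1
    push_cast
    field_simp
    ring
  have hreal : z.re * Real.log n + 1 / 2 * Real.log n + n * Real.log n - n =
      ((z + 1 / 2 + n) * (Real.log n : ℝ) - n : ℂ).re := by
    generalize Real.log n = l
    simp; ring
  rw [hreal, ← Complex.sub_re, stirlingExponent, hsplit]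
  congr 1
  push_cast
  ring

lemma factorial_eq_stirlingSeq_mul_exp {n : ℕ} (hn : 0 < n) :
    (n.factorial : ℝ) = Stirling.stirlingSeq n * √2 *
      Real.exp (1 / 2 * Real.log n + n * Real.log n - n) := by
  have hnr : (0 : ℝ) < n := Nat.cast_pos.mpr hn
  have hsqrt : Real.exp (1 / 2 * Real.log n) = √n := by
    rw [Real.sqrt_eq_rpow, Real.rpow_def_of_pos hnr, mul_comm]
  have hpow : Real.exp (n * Real.log n) = (n : ℝ) ^ n := by
    rw [Real.exp_nat_mul, Real.exp_log hnr]
  have hen : Real.exp (n : ℝ) = Real.exp 1 ^ n := by rw [← Real.exp_nat_mul, mul_one]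
  rw [Real.exp_sub, Real.exp_add, hsqrt, hpow, hen, Stirling.stirlingSeq, Real.sqrt_mul zero_le_two,
    div_pow]
  field_simp

lemma norm_GammaSeq_eq {z : ℂ} (hz : ∀ k : ℕ, z + k ≠ 0) {n : ℕ} (hn : 0 < n) :
    ‖Complex.GammaSeq z n‖ =
      Real.exp (∑ k ∈ Finset.range (n + 1), stirlingDefect (z + k)) *
      (Stirling.stirlingSeq n * √2 *
        Real.exp (z.re * Real.log n + 1 / 2 * Real.log n + n * Real.log n - n
          - (stirlingExponent (z + (n + 1 : ℕ))).re) * Real.exp (stirlingExponent z).re) := by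
  have hnr : (0 : ℝ) < n := Nat.cast_pos.mpr hn
  rw [Complex.GammaSeq, norm_div, norm_mul, Complex.norm_natCast_cpow_of_pos hn, norm_prod,
    Complex.norm_natCast, prod_norm_add_natCast_eq_exp hz, factorial_eq_stirlingSeq_mul_exp hn,
    Real.rpow_def_of_pos hnr, div_eq_mul_inv, ← Real.exp_neg]
  have hcomm : ∀ a b c d e f s : ℝ, a + b + c = d + e + f →
      Real.exp a * (s * Real.exp b) * Real.exp c =
        Real.exp d * (s * Real.exp e * Real.exp f) := fun a b c d e f s h => by
    calc _ = s * Real.exp (a + b + c) := by rw [Real.exp_add, Real.exp_add]; ring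
      _ = _ := by rw [h, Real.exp_add, Real.exp_add]; ring
  apply hcomm
  ring

/-- Two-sided Stirling estimate for `‖Γ(z)‖` on the sector `|arg z| ≤ θ` for `|z|` large. -/
theorem stmt_6 (θ : ℝ) (hθ : θ ∈ Set.Ioo (Real.pi / 2) Real.pi) :
    ∃ M > (0 : ℝ), ∀ z : ℂ, |Complex.arg z| ≤ θ → M < ‖z‖ →
      Real.sqrt (2 * Real.pi) / Real.exp 1 *
          Real.exp ((z.re - 1 / 2) * Real.log ‖z‖ - z.im * Complex.arg z - z.re)
        ≤ ‖Complex.Gamma z‖ ∧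
      ‖Complex.Gamma z‖ ≤
        Real.exp 1 * Real.sqrt (2 * Real.pi) *
          Real.exp ((z.re - 1 / 2) * Real.log ‖z‖ - z.im * Complex.arg z - z.re) := by
  have hc : 0 ≤ 1 + Real.cos θ := by linarith [Real.neg_one_le_cos θ]
  refine ⟨1 + 4 / (1 + Real.cos θ), by positivity, fun z hz hM => ?_⟩
  have hne : ∀ k : ℕ, z + k ≠ 0 := fun k hk => by
    have hzk : z = ((-k : ℝ) : ℂ) := by
      push_cast; linear_combination hk
    rcases Nat.eq_zero_or_pos k with rfl | hk0
    · have : ‖z‖ = 0 := by simp [hzk]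
      have : 0 ≤ 4 / (1 + Real.cos θ) := by positivity
      linarith
    · rw [hzk, Complex.arg_ofReal_of_neg (by simpa using hk0), abs_of_pos Real.pi_pos] at hz
      linarith [hθ.2]
  rw [← stirlingExponent_re]
  have hsum := abs_sum_stirlingDefect_le_one hθ hz hM
  set A : ℕ → ℝ := fun n => Stirling.stirlingSeq n * √2 *
    Real.exp (z.re * Real.log n + 1 / 2 * Real.log n + n * Real.log n - n
      - (stirlingExponent (z + (n + 1 : ℕ))).re) * Real.exp (stirlingExponent z).re with hA
  have hA0 : ∀ n, 0 ≤ A n := fun n => by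
    simp only [hA, Stirling.stirlingSeq]; positivity
  have hAlim : Tendsto A atTop (𝓝 (√(2 * π) * Real.exp (stirlingExponent z).re)) := by
    have h := ((Stirling.tendsto_stirlingSeq_sqrt_pi.mul_const √2).mul
      ((Real.continuous_exp.tendsto 0).comp (tendsto_sub_stirlingExponent_re z))).mul_const
        (Real.exp (stirlingExponent z).re)
    rw [Real.exp_zero, mul_one, mul_comm √π, ← Real.sqrt_mul zero_le_two] at h
    exact h
  have hGamma := (Complex.GammaSeq_tendsto_Gamma z).norm
  constructor
  · rw [div_eq_mul_inv, ← Real.exp_neg, mul_right_comm, mul_comm]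
    refine le_of_tendsto_of_tendsto (hAlim.const_mul _) hGamma ?_
    filter_upwards [eventually_gt_atTop 0] with n hn
    rw [norm_GammaSeq_eq hne hn]
    exact mul_le_mul_of_nonneg_right (Real.exp_le_exp.mpr (abs_le.mp (hsum _)).1) (hA0 n)
  · rw [mul_assoc]
    refine le_of_tendsto_of_tendsto hGamma (hAlim.const_mul _) ?_
    filter_upwards [eventually_gt_atTop 0] with n hn
    rw [norm_GammaSeq_eq hne hn]
    exact mul_le_mul_of_nonneg_right (Real.exp_le_exp.mpr (abs_le.mp (hsum _)).2) (hA0 n)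
end

section
/- Let x, y ∈ ℝ with y ≠ 0. Then the family n ↦ exp(x/(n+1)) / √( (1 + x/(n+1))² + (y/(n+1))² ), indexed by n ∈ ℕ, is multipliable, and ‖Γ(x + i·y)‖ = ( exp(−γ·x) / √(x² + y²) ) · ∏_{n=1}^∞ exp(x/n) / √( (1 + x/n)² + (y/n)² ). -/
open Complex Real

open Filter Topology in
/-- The error `w - log (1 + w)` along `w = z / (n + 1)` is summable. -/
theorem summable_div_sub_log_one_add_div (z : ℂ) :
    Summable fun n : ℕ => z / (n + 1) - Complex.log (1 + z / (n + 1)) := by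
  have hs : Summable fun n : ℕ => ‖z‖ ^ 2 * (1 / ((n : ℝ) + 1) ^ 2) := by
    have h := (summable_nat_add_iff 1).2 (Real.summable_one_div_nat_pow.2 one_lt_two)
    push_cast at h
    exact h.mul_left _
  refine hs.of_norm_bounded_eventually_nat ?_
  have hlim : Tendsto (fun n : ℕ => ‖z‖ * (1 / ((n : ℝ) + 1))) atTop (𝓝 0) := by
    simpa using tendsto_one_div_add_atTop_nhds_zero_nat.const_mul ‖z‖
  filter_upwards [hlim.eventually (gt_mem_nhds (show (0 : ℝ) < 1 / 2 by norm_num))] with n hn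
  have hw : ‖z / ((n : ℂ) + 1)‖ = ‖z‖ * (1 / ((n : ℝ) + 1)) := by
    have : ‖(n : ℂ) + 1‖ = (n : ℝ) + 1 := by exact_mod_cast Complex.norm_natCast (n + 1)
    rw [norm_div, this, mul_one_div]
  have hw2 : ‖z / ((n : ℂ) + 1)‖ < 1 / 2 := hw ▸ hn
  rw [norm_sub_rev]
  refine (Complex.norm_log_one_add_sub_self_le (hw2.trans (by norm_num))).trans ?_
  have hinv : (1 - ‖z / ((n : ℂ) + 1)‖)⁻¹ ≤ 2 := by
    rw [inv_le_comm₀ (by linarith) two_pos]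
    linarith
  calc _ ≤ ‖z / ((n : ℂ) + 1)‖ ^ 2 * 2 / 2 := by gcongr
    _ = _ := by rw [hw, mul_div_cancel_right₀ _ two_ne_zero, mul_pow, div_pow, one_pow]

/-- The modulus of `1 + (x + I y) / (n + 1)` in real coordinates. -/
theorem norm_one_add_div_succ (x y : ℝ) (n : ℕ) :
    ‖1 + ((x : ℂ) + I * y) / (n + 1)‖ =
      Real.sqrt ((1 + x / (n + 1)) ^ 2 + (y / (n + 1)) ^ 2) := by
  rw [← Complex.norm_add_mul_I]
  congr 1
  push_cast
  ring

/-- The factors of the modulus of the Weierstrass product are positive off the real axis. -/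
theorem sqrt_one_add_div_succ_pos (x : ℝ) {y : ℝ} (hy : y ≠ 0) (n : ℕ) :
    0 < Real.sqrt ((1 + x / (n + 1)) ^ 2 + (y / (n + 1)) ^ 2) := by
  have : y / ((n : ℝ) + 1) ≠ 0 := div_ne_zero hy n.cast_add_one_ne_zero
  positivity

/-- The modulus of the Weierstrass product converges off the real axis. -/
theorem multipliable_exp_div_sqrt (x : ℝ) {y : ℝ} (hy : y ≠ 0) :
    Multipliable fun n : ℕ => Real.exp (x / (n + 1)) /
      Real.sqrt ((1 + x / (n + 1)) ^ 2 + (y / (n + 1)) ^ 2) := by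
  refine Real.multipliable_of_summable_log
    (fun n => div_pos (Real.exp_pos _) (sqrt_one_add_div_succ_pos x hy n)) ?_
  refine (Complex.reCLM.summable (summable_div_sub_log_one_add_div (x + I * y))).congr fun n => ?_
  rw [Real.log_div (Real.exp_ne_zero _) (sqrt_one_add_div_succ_pos x hy n).ne', Real.log_exp,
    ← norm_one_add_div_succ, Complex.reCLM_apply, Complex.sub_re, Complex.log_re]
  congr 1
  have : ((x : ℂ) + I * y) / (n + 1) = ((x / (n + 1) : ℝ) : ℂ) + (y / (n + 1) : ℝ) * I := by
    push_cast
    ring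
  rw [this, Complex.add_re, Complex.ofReal_re, Complex.re_ofReal_mul,
    Complex.I_re, mul_zero, add_zero]

/-- Partial products of the Weierstrass product compute the modulus of `Complex.GammaSeq`. -/
theorem norm_GammaSeq_eq_s7 (x : ℝ) {y : ℝ} (hy : y ≠ 0) {n : ℕ} (hn : 0 < n) :
    ‖Complex.GammaSeq (x + I * y) n‖ =
      Real.exp (-((harmonic n - Real.log n) * x)) / Real.sqrt (x ^ 2 + y ^ 2) *
        ∏ k ∈ Finset.range n, Real.exp (x / (k + 1)) /
          Real.sqrt ((1 + x / (k + 1)) ^ 2 + (y / (k + 1)) ^ 2) := by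
  have hfac : ∀ k : ℕ, ‖(x : ℂ) + I * y + ((k + 1 : ℕ) : ℂ)‖ =
      ((k : ℝ) + 1) * Real.sqrt ((1 + x / (k + 1)) ^ 2 + (y / (k + 1)) ^ 2) := fun k => by
    have hk : (k : ℂ) + 1 ≠ 0 := k.cast_add_one_ne_zero
    have hk' : ‖(k : ℂ) + 1‖ = (k : ℝ) + 1 := by exact_mod_cast Complex.norm_natCast (k + 1)
    rw [← norm_one_add_div_succ, ← hk', ← norm_mul]
    congr 1
    push_cast
    field_simp
    ring
  have hzero : ‖(x : ℂ) + I * y + ((0 : ℕ) : ℂ)‖ = Real.sqrt (x ^ 2 + y ^ 2) := by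
    rw [← Complex.norm_add_mul_I]
    congr 1
    push_cast
    ring
  have hH : ∏ k ∈ Finset.range n, Real.exp (x / (k + 1)) = Real.exp (harmonic n * x) := by
    rw [← Real.exp_sum]
    congr 1
    simp only [harmonic, Rat.cast_sum, Finset.sum_mul]
    refine Finset.sum_congr rfl fun k _ => ?_
    push_cast
    ring
  have hfact : ((n.factorial : ℕ) : ℝ) = ∏ k ∈ Finset.range n, ((k : ℝ) + 1) := by
    rw [← Finset.prod_range_add_one_eq_factorial]
    push_cast
    rfl
  have hfact0 : ∏ k ∈ Finset.range n, ((k : ℝ) + 1) ≠ 0 := hfact ▸ by positivity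
  have hexp : Real.exp (-((harmonic n - Real.log n) * x)) * Real.exp (harmonic n * x) =
      (n : ℝ) ^ x := by
    rw [← Real.exp_add, Real.rpow_def_of_pos (by exact_mod_cast hn)]
    congr 1
    ring
  rw [Complex.GammaSeq, norm_div, norm_mul, Complex.norm_natCast_cpow_of_pos hn,
    Complex.norm_natCast, norm_prod, Finset.prod_range_succ', hzero,
    Finset.prod_congr rfl fun k _ => hfac k, Finset.prod_mul_distrib, Finset.prod_div_distrib,
    hH, hfact, show ((x : ℂ) + I * y).re = x by simp, ← hexp]
  have hS : ∏ k ∈ Finset.range n, Real.sqrt ((1 + x / (k + 1)) ^ 2 + (y / (k + 1)) ^ 2) ≠ 0 :=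
    Finset.prod_ne_zero_iff.2 fun k _ => (sqrt_one_add_div_succ_pos x hy k).ne'
  have h0 : Real.sqrt (x ^ 2 + y ^ 2) ≠ 0 := by positivity
  field_simp

/-- Modulus form of the Weierstrass product for `Γ`. -/
theorem stmt_7 (x y : ℝ) (hy : y ≠ 0) :
    Multipliable (fun n : ℕ =>
      Real.exp (x / (n + 1)) /
        Real.sqrt ((1 + x / (n + 1)) ^ 2 + (y / (n + 1)) ^ 2)) ∧
    ‖Complex.Gamma (x + Complex.I * y)‖ =
      Real.exp (-(Real.eulerMascheroniConstant * x)) / Real.sqrt (x ^ 2 + y ^ 2) *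
        ∏' n : ℕ,
          Real.exp (x / (n + 1)) /
            Real.sqrt ((1 + x / (n + 1)) ^ 2 + (y / (n + 1)) ^ 2) := by
  have hm := multipliable_exp_div_sqrt x hy
  refine ⟨hm, tendsto_nhds_unique (Complex.GammaSeq_tendsto_Gamma (x + I * y)).norm ?_⟩
  have hexp := (Real.continuous_exp.tendsto _).comp
    (Real.tendsto_harmonic_sub_log.mul_const x).neg
  refine ((hexp.div_const (Real.sqrt (x ^ 2 + y ^ 2))).mul
    hm.hasProd.tendsto_prod_nat).congr' ?_
  filter_upwards [Filter.eventually_gt_atTop 0] with n hn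
  exact (norm_GammaSeq_eq_s7 x hy hn).symm
end

section
/- Let x, y ∈ ℝ with y ≠ 0. Then the function x' ↦ ‖Γ(x' + i·y)‖ has derivative at x equal to ‖Γ(x + i·y)‖ · ( −γ − x/(x² + y²) + ∑_{n=1}^∞ ( 1/n − (n + x)/((n + x)² + y²) ) ). -/
open Complex Real

open Filter Topology

/-- The norm of Euler's product `Complex.GammaSeq` at `x + iy`, in logarithmic form. -/
lemma log_norm_GammaSeq (x : ℝ) {y : ℝ} (hy : y ≠ 0) {n : ℕ} (hn : n ≠ 0) :
    Real.log ‖Complex.GammaSeq (x + Complex.I * y) n‖ =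
      x * Real.log n + Real.log n.factorial -
        ∑ j ∈ Finset.range (n + 1), Real.log ((j + x) ^ 2 + y ^ 2) / 2 := by
  have hnorm (j : ℕ) : ‖(x + Complex.I * y + j : ℂ)‖ = √((j + x) ^ 2 + y ^ 2) := by
    rw [show (x + Complex.I * y + j : ℂ) = ((j + x : ℝ) : ℂ) + y * Complex.I by push_cast; ring,
      Complex.norm_add_mul_I]
  have hpos (j : ℕ) : 0 < ((j : ℝ) + x) ^ 2 + y ^ 2 := by positivity
  have hn' : (0 : ℝ) < n := by positivity
  have hpow : (n : ℝ) ^ x ≠ 0 := (Real.rpow_pos_of_pos hn' x).ne'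
  rw [Complex.GammaSeq, norm_div, norm_mul, norm_prod,
    Complex.norm_natCast_cpow_of_pos (Nat.pos_of_ne_zero hn), Complex.norm_natCast,
    Finset.prod_congr rfl fun j _ => hnorm j]
  have hre : (x + Complex.I * y : ℂ).re = x := by simp
  rw [hre, Real.log_div (mul_ne_zero hpow (by positivity))
    (Finset.prod_ne_zero_iff.2 fun j _ => (Real.sqrt_pos.2 (hpos j)).ne'),
    Real.log_mul hpow (by positivity), Real.log_rpow hn',
    Real.log_prod fun j _ => (Real.sqrt_pos.2 (hpos j)).ne']
  simp only [Real.log_sqrt (hpos _).le]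

/-- Uniform quadratic decay, for bounded `x`, of the terms of the series for the real part of the
digamma function. -/
lemma abs_inv_sub_div_sq_add_sq_le {x y R m : ℝ} (hy : y ≠ 0) (hm : 1 ≤ m) (hx : |x| ≤ R) :
    |1 / m - (m + x) / ((m + x) ^ 2 + y ^ 2)| ≤
      (R ^ 2 + R + y ^ 2) * (R ^ 2 + y ^ 2) / y ^ 2 * (1 / m ^ 2) := by
  have hm0 : 0 < m := by linarith
  have hR : 0 ≤ R := (abs_nonneg x).trans hx
  have hy2 : 0 < y ^ 2 := by positivity
  have hD : 0 < (m + x) ^ 2 + y ^ 2 := by positivity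
  have hx2 : x ^ 2 ≤ R ^ 2 := by
    rw [← sq_abs]
    gcongr
  have hlow : y ^ 2 * m ^ 2 ≤ (R ^ 2 + y ^ 2) * ((m + x) ^ 2 + y ^ 2) := by
    calc y ^ 2 * m ^ 2 ≤ (x ^ 2 + y ^ 2) * ((m + x) ^ 2 + y ^ 2) := by
          nlinarith [sq_nonneg (x * (m + x) + y ^ 2)]
      _ ≤ _ := by gcongr
  have hnum : |x * (m + x) + y ^ 2| ≤ (R ^ 2 + R + y ^ 2) * m := by
    have h1 : |x * m| ≤ R * m := by
      rw [abs_mul, abs_of_pos hm0]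
      gcongr
    have h2 : x * (m + x) + y ^ 2 = x * m + x ^ 2 + y ^ 2 := by ring
    have h3 : R ^ 2 + y ^ 2 ≤ (R ^ 2 + y ^ 2) * m := le_mul_of_one_le_right (by positivity) hm
    rw [h2, abs_le]
    obtain ⟨h4, h5⟩ := abs_le.1 h1
    constructor <;> nlinarith [sq_nonneg x]
  have heq : 1 / m - (m + x) / ((m + x) ^ 2 + y ^ 2) =
      (x * (m + x) + y ^ 2) / (m * ((m + x) ^ 2 + y ^ 2)) := by
    field_simp
    ring
  rw [heq, abs_div, abs_of_pos (mul_pos hm0 hD), div_le_iff₀ (mul_pos hm0 hD)]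
  calc |x * (m + x) + y ^ 2| ≤ (R ^ 2 + R + y ^ 2) * m := hnum
    _ = (R ^ 2 + R + y ^ 2) / (y ^ 2 * m) * (y ^ 2 * m ^ 2) := by field_simp
    _ ≤ (R ^ 2 + R + y ^ 2) / (y ^ 2 * m) * ((R ^ 2 + y ^ 2) * ((m + x) ^ 2 + y ^ 2)) := by
      gcongr
    _ = _ := by field_simp

lemma hasDerivAt_log_norm_Gamma (x : ℝ) {y : ℝ} (hy : y ≠ 0) :
    HasDerivAt (fun x' : ℝ => Real.log ‖Complex.Gamma (x' + Complex.I * y)‖)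
      (-Real.eulerMascheroniConstant - x / (x ^ 2 + y ^ 2) +
        ∑' n : ℕ, (1 / ((n : ℝ) + 1) -
          (((n : ℝ) + 1) + x) / ((((n : ℝ) + 1) + x) ^ 2 + y ^ 2))) x := by
  set s : Set ℝ := Metric.ball 0 (|x| + 1)
  have hsum : TendstoUniformlyOn
      (fun N (t : ℝ) => ∑ n ∈ Finset.range N, (1 / ((n : ℝ) + 1) -
          (((n : ℝ) + 1) + t) / ((((n : ℝ) + 1) + t) ^ 2 + y ^ 2)))
      (fun t => ∑' n : ℕ, (1 / ((n : ℝ) + 1) -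
          (((n : ℝ) + 1) + t) / ((((n : ℝ) + 1) + t) ^ 2 + y ^ 2))) atTop s := by
    refine tendstoUniformlyOn_tsum_nat (Summable.mul_left _ ?_) fun n t ht =>
      abs_inv_sub_div_sq_add_sq_le hy (by linarith [n.cast_nonneg (α := ℝ)])
        (mem_ball_zero_iff.1 ht).le
    exact_mod_cast (summable_nat_add_iff 1).2 (Real.summable_one_div_nat_pow.2 one_lt_two)
  have hγ : Tendsto (fun n : ℕ => -((harmonic n : ℝ) - Real.log n)) atTop
      (𝓝 (-Real.eulerMascheroniConstant)) := Real.tendsto_harmonic_sub_log.neg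
  have hconst : TendstoUniformlyOn (fun (_ : ℕ) (t : ℝ) => t / (t ^ 2 + y ^ 2))
      (fun t => t / (t ^ 2 + y ^ 2)) atTop s :=
    fun _ hu => Eventually.of_forall fun _ _ _ => refl_mem_uniformity hu
  refine hasDerivAt_of_tendstoUniformlyOn (𝕜 := ℝ) (l := atTop) (s := s)
    (f := fun n (t : ℝ) => Real.log ‖Complex.GammaSeq (t + Complex.I * y) n‖)
    (g' := fun t : ℝ => -Real.eulerMascheroniConstant - t / (t ^ 2 + y ^ 2) +
        ∑' n : ℕ, (1 / ((n : ℝ) + 1) -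
          (((n : ℝ) + 1) + t) / ((((n : ℝ) + 1) + t) ^ 2 + y ^ 2)))
    Metric.isOpen_ball (((hγ.tendstoUniformlyOn_const s).sub hconst).add hsum) ?_ ?_ ?_
  · filter_upwards [eventually_ne_atTop 0] with n hn t _
    simp only [log_norm_GammaSeq _ hy hn]
    have hterm (j : ℕ) : HasDerivAt (fun t : ℝ => Real.log ((j + t) ^ 2 + y ^ 2) / 2)
        ((j + t) / ((j + t) ^ 2 + y ^ 2)) t := by
      have hD : ((j : ℝ) + t) ^ 2 + y ^ 2 ≠ 0 := by positivity
      convert! ((((hasDerivAt_id t).const_add (j : ℝ)).pow 2).add_const (y ^ 2)).log hD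
        |>.div_const 2 using 1
      simp
      field_simp
    convert! (((hasDerivAt_id t).mul_const (Real.log n)).add_const (Real.log n.factorial)).sub
      (HasDerivAt.fun_sum fun j (_ : j ∈ Finset.range (n + 1)) => hterm j) using 1
    simp only [Pi.add_apply, Pi.sub_apply, Finset.sum_range_succ', Finset.sum_sub_distrib, harmonic]
    push_cast
    simp only [one_div, zero_add]
    ring
  · intro t _
    refine ((Complex.GammaSeq_tendsto_Gamma _).norm).log (norm_ne_zero_iff.2 ?_)
    refine Complex.Gamma_ne_zero fun m h => hy ?_
    simpa using congrArg Complex.im h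
  · simp [s]

/-- Derivative in `x` of `x ↦ ‖Γ(x + iy)‖` via the logarithmic derivative of the
Weierstrass product. -/
theorem stmt_8 (x y : ℝ) (hy : y ≠ 0) :
    HasDerivAt (fun x' : ℝ => ‖Complex.Gamma (x' + Complex.I * y)‖)
      (‖Complex.Gamma (x + Complex.I * y)‖ *
        (-Real.eulerMascheroniConstant - x / (x ^ 2 + y ^ 2) +
          ∑' n : ℕ,
            (1 / ((n : ℝ) + 1) -
              (((n : ℝ) + 1) + x) / ((((n : ℝ) + 1) + x) ^ 2 + y ^ 2)))) x := by
  have hexp (t : ℝ) : Real.exp (Real.log ‖Complex.Gamma (t + Complex.I * y)‖) =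
      ‖Complex.Gamma (t + Complex.I * y)‖ := by
    refine Real.exp_log (norm_pos_iff.2 (Complex.Gamma_ne_zero fun m h => hy ?_))
    simpa using congrArg Complex.im h
  simpa only [hexp] using (hasDerivAt_log_norm_Gamma x hy).exp
end

section
/- For every y ∈ ℝ with y ≥ 2, the function x ↦ ‖Γ(x + i·y)‖ is strictly monotone increasing on ℝ; in particular it is injective. -/
open Filter Topology

/-- A lower Riemann-type bound: `t / (t² + y²)` is at most a logarithmic difference, for `t ≥ 0`. -/
lemma div_sq_add_sq_le_half_log_sub {t y : ℝ} (ht : 0 ≤ t) (hy : 2 ≤ y) :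
    t / (t ^ 2 + y ^ 2) ≤
      Real.log ((t + 1 / 2) ^ 2 + (y ^ 2 - 1 / 4)) / 2 -
        Real.log ((t - 1 / 2) ^ 2 + (y ^ 2 - 1 / 4)) / 2 := by
  have hA : 0 < t ^ 2 + y ^ 2 := by nlinarith
  have hlt : t / (t ^ 2 + y ^ 2) < 1 := by rw [div_lt_one hA]; nlinarith [sq_nonneg (t - 1 / 2)]
  have h := Real.sum_range_le_log_div (div_nonneg ht hA.le) hlt 1
  have hsub : 0 < (t - 1 / 2) ^ 2 + (y ^ 2 - 1 / 4) := by nlinarith [sq_nonneg (t - 1 / 2)]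
  have hadd : 0 < (t + 1 / 2) ^ 2 + (y ^ 2 - 1 / 4) := by nlinarith [sq_nonneg (t + 1 / 2)]
  have e : (1 + t / (t ^ 2 + y ^ 2)) / (1 - t / (t ^ 2 + y ^ 2)) =
      ((t + 1 / 2) ^ 2 + (y ^ 2 - 1 / 4)) / ((t - 1 / 2) ^ 2 + (y ^ 2 - 1 / 4)) := by
    have : 1 - t / (t ^ 2 + y ^ 2) ≠ 0 := by linarith
    rw [div_eq_div_iff this hsub.ne']
    field_simp
    ring
  rw [e, Real.log_div hadd.ne' hsub.ne'] at h
  simp at h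
  norm_num at h ⊢
  linarith

/-- An upper bound for a logarithmic difference by `t / (t² + y²)`, for `t ≥ 0`. -/
lemma half_log_sub_le_div_sq_add_sq {t y : ℝ} (ht : 0 ≤ t) :
    Real.log ((t + 1 / 2) ^ 2 + (y ^ 2 + 3 / 4)) / 2 -
        Real.log ((t - 1 / 2) ^ 2 + (y ^ 2 + 3 / 4)) / 2 ≤ t / (t ^ 2 + y ^ 2) := by
  rcases ht.eq_or_lt with rfl | ht'
  · norm_num
  have hA : 0 < t ^ 2 + y ^ 2 + 1 := by positivity
  have hlt : t / (t ^ 2 + y ^ 2 + 1) < 1 := by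
    rw [div_lt_one hA]; nlinarith [sq_nonneg (t - 1 / 2), sq_nonneg y]
  have h := Real.log_div_le_sum_range_add (div_nonneg ht hA.le) hlt 0
  have hsub : 0 < (t - 1 / 2) ^ 2 + (y ^ 2 + 3 / 4) := by positivity
  have hadd : 0 < (t + 1 / 2) ^ 2 + (y ^ 2 + 3 / 4) := by positivity
  have e : (1 + t / (t ^ 2 + y ^ 2 + 1)) / (1 - t / (t ^ 2 + y ^ 2 + 1)) =
      ((t + 1 / 2) ^ 2 + (y ^ 2 + 3 / 4)) / ((t - 1 / 2) ^ 2 + (y ^ 2 + 3 / 4)) := by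
    have : 1 - t / (t ^ 2 + y ^ 2 + 1) ≠ 0 := by linarith
    rw [div_eq_div_iff this hsub.ne']
    field_simp
    ring
  rw [e, Real.log_div hadd.ne' hsub.ne'] at h
  have hsq : 0 < 1 - (t / (t ^ 2 + y ^ 2 + 1)) ^ 2 := by
    have := div_nonneg ht hA.le
    nlinarith
  have hB : 0 < t ^ 2 + y ^ 2 := by positivity
  have h' : t / (t ^ 2 + y ^ 2 + 1) / (1 - (t / (t ^ 2 + y ^ 2 + 1)) ^ 2) ≤
      t / (t ^ 2 + y ^ 2) := by
    rw [div_div]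
    refine div_le_div_of_nonneg_left ht hB ?_
    have e' : (t ^ 2 + y ^ 2 + 1) * (1 - (t / (t ^ 2 + y ^ 2 + 1)) ^ 2) =
        (t ^ 2 + y ^ 2) + (y ^ 2 + 1) / (t ^ 2 + y ^ 2 + 1) := by
      field_simp
      ring
    rw [e']
    have : 0 ≤ (y ^ 2 + 1) / (t ^ 2 + y ^ 2 + 1) := by positivity
    linarith
  simp at h
  norm_num at h ⊢
  linarith

/-- A potential whose unit increments dominate `t / (t² + y²)`. -/
noncomputable def logPotential (y t : ℝ) : ℝ :=
  if 0 ≤ t then Real.log ((t - 1 / 2) ^ 2 + (y ^ 2 - 1 / 4)) / 2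
  else Real.log ((t - 1 / 2) ^ 2 + (y ^ 2 + 3 / 4)) / 2 -
    Real.log (y ^ 2 + 3 / 4) / 2 + Real.log (y ^ 2 - 1 / 4) / 2

lemma div_sq_add_sq_le_logPotential_sub {y : ℝ} (hy : 2 ≤ y) (t : ℝ) :
    t / (t ^ 2 + y ^ 2) ≤ logPotential y (t + 1) - logPotential y t := by
  have e : t + 1 - 1 / 2 = t + 1 / 2 := by ring
  have hb : 0 < y ^ 2 - 1 / 4 := by nlinarith
  unfold logPotential
  rw [e]
  rcases le_or_gt 0 t with ht | ht
  · rw [if_pos (by linarith), if_pos ht]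
    exact div_sq_add_sq_le_half_log_sub ht hy
  · have h := half_log_sub_le_div_sq_add_sq (y := y) (neg_nonneg.2 ht.le)
    have e₁ : (-t + 1 / 2) ^ 2 = (t - 1 / 2) ^ 2 := by ring
    have e₂ : (-t - 1 / 2) ^ 2 = (t + 1 / 2) ^ 2 := by ring
    rw [e₁, e₂, neg_sq, neg_div] at h
    rw [if_neg ht.not_ge]
    split_ifs
    · have key : Real.log ((t + 1 / 2) ^ 2 + (y ^ 2 + 3 / 4)) + Real.log (y ^ 2 - 1 / 4) ≤
          Real.log ((t + 1 / 2) ^ 2 + (y ^ 2 - 1 / 4)) + Real.log (y ^ 2 + 3 / 4) := by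
        rw [← Real.log_mul (by positivity) hb.ne', ← Real.log_mul (by positivity) (by positivity)]
        apply Real.log_le_log (by positivity)
        nlinarith [sq_nonneg (t + 1 / 2)]
      linarith
    · linarith

lemma half_log_le_logPotential {y : ℝ} (hy : 2 ≤ y) (t : ℝ) :
    Real.log (15 / 4) / 2 ≤ logPotential y t := by
  have hb : 15 / 4 ≤ y ^ 2 - 1 / 4 := by nlinarith
  unfold logPotential
  split_ifs
  · have := Real.log_le_log (by norm_num)
      (show (15 / 4 : ℝ) ≤ (t - 1 / 2) ^ 2 + (y ^ 2 - 1 / 4) by nlinarith [sq_nonneg (t - 1 / 2)])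
    linarith
  · have h₁ := Real.log_le_log (by norm_num) hb
    have h₂ := Real.log_le_log (show 0 < y ^ 2 + 3 / 4 by positivity)
      (show y ^ 2 + 3 / 4 ≤ (t - 1 / 2) ^ 2 + (y ^ 2 + 3 / 4) by nlinarith [sq_nonneg (t - 1 / 2)])
    linarith

lemma sum_div_sq_add_sq_le {y : ℝ} (hy : 2 ≤ y) (x : ℝ) (n : ℕ) :
    ∑ k ∈ Finset.range n, (x + k) / ((x + k) ^ 2 + y ^ 2) ≤
      logPotential y (x + n) - logPotential y x := by
  have h := Finset.sum_le_sum fun k (_ : k ∈ Finset.range n) =>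
    div_sq_add_sq_le_logPotential_sub hy (x + k)
  have e := Finset.sum_range_sub (fun k : ℕ => logPotential y (x + k)) n
  simp only [Nat.cast_add, Nat.cast_one, Nat.cast_zero, add_zero, ← add_assoc] at e
  exact h.trans e.le

lemma eventually_logPotential_le (y M : ℝ) (hy : 2 ≤ y) :
    ∀ᶠ n : ℕ in atTop, ∀ x ∈ Set.Icc (-M) M,
      logPotential y (x + (n + 1 : ℕ)) ≤ Real.log n + Real.log 2 / 2 := by
  filter_upwards [eventually_ge_atTop ⌈4 * |M| + 4 + y ^ 2⌉₊] with n hn x ⟨hx₁, hx₂⟩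
  have hn' : 4 * |M| + 4 + y ^ 2 ≤ n := Nat.ceil_le.1 hn
  have hM := le_abs_self M
  have hM₀ := abs_nonneg M
  have hy₀ := sq_nonneg y
  have hn₀ : (0 : ℝ) < n := by linarith
  unfold logPotential
  push_cast
  rw [if_pos (by linarith)]
  have h : Real.log ((x + (n + 1) - 1 / 2) ^ 2 + (y ^ 2 - 1 / 4)) ≤ Real.log (n ^ 2 * 2) := by
    apply Real.log_le_log (by nlinarith [sq_nonneg (x + (n + 1) - 1 / 2)])
    have h₁ : (x + (n + 1) - 1 / 2) ^ 2 ≤ (n + |M| + 1 / 2) ^ 2 :=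
      pow_le_pow_left₀ (by linarith) (by linarith) 2
    nlinarith
  rw [Real.log_mul (by positivity) (by norm_num), Real.log_pow] at h
  push_cast at h
  linarith

/-- The logarithm of `‖Complex.GammaSeq (x + i y) n‖`. -/
noncomputable def logNormGammaSeq (y : ℝ) (n : ℕ) (x : ℝ) : ℝ :=
  x * Real.log n + Real.log n.factorial -
    ∑ k ∈ Finset.range (n + 1), Real.log ((x + k) ^ 2 + y ^ 2) / 2

lemma norm_GammaSeq_eq_exp {y : ℝ} (hy : y ≠ 0) {n : ℕ} (hn : n ≠ 0) (x : ℝ) :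
    ‖Complex.GammaSeq (x + Complex.I * y) n‖ = Real.exp (logNormGammaSeq y n x) := by
  have hn₀ : (0 : ℝ) < n := by positivity
  have hk (k : ℕ) : ‖(x + Complex.I * y + k : ℂ)‖ =
      Real.exp (Real.log ((x + k) ^ 2 + y ^ 2) / 2) := by
    have e : (x + Complex.I * y + k : ℂ) = ((x + k : ℝ) : ℂ) + (y : ℝ) * Complex.I := by
      push_cast; ring
    have hp : 0 < (x + k) ^ 2 + y ^ 2 := by positivity
    rw [e, Complex.norm_add_mul_I, ← Real.log_sqrt hp.le, Real.exp_log (Real.sqrt_pos.2 hp)]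
  rw [Complex.GammaSeq, norm_div, norm_mul, norm_prod, logNormGammaSeq, Real.exp_sub,
    Real.exp_add, Real.exp_log (by positivity), Real.exp_sum,
    Complex.norm_natCast_cpow_of_pos (Nat.pos_of_ne_zero hn), Real.rpow_def_of_pos hn₀,
    Finset.prod_congr rfl fun k _ => hk k]
  simp [mul_comm]

lemma hasDerivAt_logNormGammaSeq {y : ℝ} (hy : y ≠ 0) (n : ℕ) (x : ℝ) :
    HasDerivAt (logNormGammaSeq y n)
      (Real.log n - ∑ k ∈ Finset.range (n + 1), (x + k) / ((x + k) ^ 2 + y ^ 2)) x := by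
  have hk (k : ℕ) : HasDerivAt (fun x : ℝ => Real.log ((x + k) ^ 2 + y ^ 2) / 2)
      ((x + k) / ((x + k) ^ 2 + y ^ 2)) x := by
    have hp : (x + k) ^ 2 + y ^ 2 ≠ 0 := by positivity
    have h := ((((hasDerivAt_id x).add_const (k : ℝ)).pow 2).add_const (y ^ 2)).log hp
    refine (h.div_const 2).congr_deriv ?_
    simp
    field_simp
  have h := (((hasDerivAt_id x).mul_const (Real.log n)).add_const
    (Real.log n.factorial)).sub
    (HasDerivAt.fun_sum fun k (_ : k ∈ Finset.range (n + 1)) => hk k)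
  rw [one_mul] at h
  exact h

lemma eventually_mul_sub_le_logNormGammaSeq_sub {y : ℝ} (hy : 2 ≤ y) {a b : ℝ} (hab : a ≤ b) :
    ∀ᶠ n : ℕ in atTop,
      Real.log (15 / 8) / 2 * (b - a) ≤ logNormGammaSeq y n b - logNormGammaSeq y n a := by
  filter_upwards [eventually_logPotential_le y (|a| + |b|) hy] with n hn
  have hd := hasDerivAt_logNormGammaSeq (show y ≠ 0 by linarith) n
  refine (convex_Icc a b).mul_sub_le_image_sub_of_le_deriv
    (fun x _ => (hd x).continuousAt.continuousWithinAt)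
    (fun x _ => (hd x).differentiableAt.differentiableWithinAt)
    (fun x hx => ?_) a (Set.left_mem_Icc.2 hab) b (Set.right_mem_Icc.2 hab) hab
  rw [interior_Icc] at hx
  have h₁ := hn x ⟨by linarith [hx.1, neg_abs_le a, abs_nonneg b],
    by linarith [hx.2, le_abs_self b, abs_nonneg a]⟩
  have h₂ := sum_div_sq_add_sq_le hy x (n + 1)
  have h₃ := half_log_le_logPotential hy x
  have h₄ : Real.log (15 / 8) = Real.log (15 / 4) - Real.log 2 := by
    rw [← Real.log_div (by norm_num) (by norm_num)]; norm_num
  rw [(hd x).deriv]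
  linarith

lemma exp_mul_norm_Gamma_le {y : ℝ} (hy : 2 ≤ y) {a b : ℝ} (hab : a ≤ b) :
    Real.exp (Real.log (15 / 8) / 2 * (b - a)) * ‖Complex.Gamma (a + Complex.I * y)‖ ≤
      ‖Complex.Gamma (b + Complex.I * y)‖ := by
  refine le_of_tendsto_of_tendsto
    ((Complex.GammaSeq_tendsto_Gamma (a + Complex.I * y)).norm.const_mul _)
    (Complex.GammaSeq_tendsto_Gamma (b + Complex.I * y)).norm ?_
  filter_upwards [eventually_mul_sub_le_logNormGammaSeq_sub hy hab, eventually_ne_atTop 0]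
    with n hn hn₀
  have hy₀ : y ≠ 0 := by linarith
  rw [norm_GammaSeq_eq_exp hy₀ hn₀, norm_GammaSeq_eq_exp hy₀ hn₀, ← Real.exp_add]
  exact Real.exp_le_exp.2 (by linarith)

/-- For `y ≥ 2`, the map `x ↦ ‖Γ(x + iy)‖` is strictly increasing, hence injective. -/
theorem stmt_11 (y : ℝ) (hy : 2 ≤ y) :
    StrictMono (fun x : ℝ => ‖Complex.Gamma (x + Complex.I * y)‖) ∧
    Function.Injective (fun x : ℝ => ‖Complex.Gamma (x + Complex.I * y)‖) := by
  have hmono : StrictMono (fun x : ℝ => ‖Complex.Gamma (x + Complex.I * y)‖) := by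
    intro a b hab
    have hpos : 0 < ‖Complex.Gamma (a + Complex.I * y)‖ := by
      refine norm_pos_iff.2 (Complex.Gamma_ne_zero fun m hm => ?_)
      have := congrArg Complex.im hm
      simp at this
      linarith
    have hexp : 1 < Real.exp (Real.log (15 / 8) / 2 * (b - a)) :=
      Real.one_lt_exp_iff.2 (mul_pos (half_pos (Real.log_pos (by norm_num))) (sub_pos.2 hab))
    exact (lt_mul_of_one_lt_left hpos hexp).trans_le (exp_mul_norm_Gamma_le hy hab.le)
  exact ⟨hmono, hmono.injective⟩
end

section
/- For every x ∈ ℝ, the function y ↦ ‖Γ(x + i·y)‖ is strictly decreasing on (0, ∞); in particular it is injective on (0, ∞). -/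
theorem norm_add_I_mul_lt_norm_add_I_mul (x : ℝ) {a b : ℝ} (ha : 0 < a) (hab : a < b) :
    ‖(x + Complex.I * a : ℂ)‖ < ‖(x + Complex.I * b : ℂ)‖ := by
  rw [mul_comm Complex.I, mul_comm Complex.I, Complex.norm_add_mul_I, Complex.norm_add_mul_I]
  exact Real.sqrt_lt_sqrt (by positivity) (by gcongr)

theorem ofReal_add_I_mul_ne_neg_natCast (x : ℝ) {a : ℝ} (ha : 0 < a) (m : ℕ) :
    (x + Complex.I * a : ℂ) ≠ -m := by
  intro h
  have h_im := congrArg Complex.im h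
  simp at h_im
  exact ha.ne' h_im

theorem norm_GammaSeq_add_I_mul_le (x : ℝ) {a b : ℝ} (ha : 0 < a) (hab : a < b) {n : ℕ}
    (hn : 0 < n) :
    ‖Complex.GammaSeq (x + Complex.I * b) n‖ ≤ ‖Complex.GammaSeq (x + Complex.I * a) n‖ := by
  have hpow (c : ℝ) : ‖(n : ℂ) ^ (x + Complex.I * c : ℂ)‖ = (n : ℝ) ^ x := by
    rw [Complex.norm_natCast_cpow_of_pos hn]
    simp
  simp only [Complex.GammaSeq, norm_div, norm_mul, norm_prod, hpow]
  have hle (j : ℕ) : ‖(x + Complex.I * a + j : ℂ)‖ ≤ ‖(x + Complex.I * b + j : ℂ)‖ := by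
    have h := (norm_add_I_mul_lt_norm_add_I_mul (x + j) ha hab).le
    push_cast at h
    rwa [add_right_comm, add_right_comm _ (j : ℂ)] at h
  have hpos (j : ℕ) : 0 < ‖(x + Complex.I * a + j : ℂ)‖ :=
    norm_pos_iff.mpr fun h =>
      ofReal_add_I_mul_ne_neg_natCast x ha j (eq_neg_of_add_eq_zero_left h)
  exact div_le_div_of_nonneg_left (by positivity) (Finset.prod_pos fun j _ => hpos j)
    (Finset.prod_le_prod (fun j _ => (hpos j).le) fun j _ => hle j)

theorem norm_Gamma_add_I_mul_le (x : ℝ) {a b : ℝ} (ha : 0 < a) (hab : a < b) :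
    ‖Complex.Gamma (x + Complex.I * b)‖ ≤ ‖Complex.Gamma (x + Complex.I * a)‖ := by
  refine le_of_tendsto_of_tendsto (Complex.GammaSeq_tendsto_Gamma _).norm
    (Complex.GammaSeq_tendsto_Gamma _).norm ?_
  filter_upwards [Filter.eventually_gt_atTop 0] with n hn
  exact norm_GammaSeq_add_I_mul_le x ha hab hn

theorem norm_Gamma_add_I_mul_eq_div (x : ℝ) {a : ℝ} (ha : 0 < a) :
    ‖Complex.Gamma (x + Complex.I * a)‖ =
      ‖Complex.Gamma ((x + 1 : ℝ) + Complex.I * a)‖ / ‖(x + Complex.I * a : ℂ)‖ := by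
  have h0 : (x + Complex.I * a : ℂ) ≠ 0 := by
    simpa using ofReal_add_I_mul_ne_neg_natCast x ha 0
  have h : (((x + 1 : ℝ) : ℂ) + Complex.I * a) = x + Complex.I * a + 1 := by
    push_cast
    ring
  rw [h, Complex.Gamma_add_one _ h0, norm_mul, mul_div_cancel_left₀ _ (norm_ne_zero_iff.mpr h0)]

/-- For every `x`, the map `y ↦ ‖Γ(x + iy)‖` is strictly decreasing on `(0, ∞)`,
hence injective there. -/
theorem stmt_12 (x : ℝ) :
    StrictAntiOn (fun y : ℝ => ‖Complex.Gamma (x + Complex.I * y)‖) (Set.Ioi 0) ∧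
    Set.InjOn (fun y : ℝ => ‖Complex.Gamma (x + Complex.I * y)‖) (Set.Ioi 0) := by
  have hanti : StrictAntiOn (fun y : ℝ => ‖Complex.Gamma (x + Complex.I * y)‖) (Set.Ioi 0) := by
    intro a ha b hb hab
    have ha' : 0 < a := ha
    simp only [norm_Gamma_add_I_mul_eq_div x ha, norm_Gamma_add_I_mul_eq_div x hb]
    have h0 : (x + Complex.I * a : ℂ) ≠ 0 := by
      simpa using ofReal_add_I_mul_ne_neg_natCast x ha' 0
    exact div_lt_div₀' (norm_Gamma_add_I_mul_le (x + 1) ha hab)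
      (norm_add_I_mul_lt_norm_add_I_mul x ha hab)
      (norm_pos_iff.mpr (Complex.Gamma_ne_zero (ofReal_add_I_mul_ne_neg_natCast (x + 1) ha')))
      (norm_pos_iff.mpr h0)
  exact ⟨hanti, hanti.injOn⟩
end

section
/- For every y ∈ ℝ with y ≠ 0 and every c ∈ ℝ, the function x ↦ ‖Γ(x + i·y)‖ · exp(−c·x) tends to +∞ as x → +∞. In other words, ‖Γ(x + i·y)‖ grows faster than any exponential as x → +∞. -/
open Filter

/-- A function that is bounded below by a positive constant on a unit interval and at least doubles
under every later unit step tends to infinity. -/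
theorem tendsto_atTop_of_two_mul_le_add_one {f : ℝ → ℝ} {a m : ℝ} (hm : 0 < m)
    (hbase : ∀ x ∈ Set.Icc a (a + 1), m ≤ f x) (hstep : ∀ x, a ≤ x → 2 * f x ≤ f (x + 1)) :
    Tendsto f atTop atTop := by
  have iter : ∀ (n : ℕ) (t : ℝ), t ∈ Set.Icc a (a + 1) → 2 ^ n * m ≤ f (t + n) := by
    intro n t ht
    induction n with
    | zero => simpa using hbase t ht
    | succ k ih =>
      have h := hstep (t + k) (ht.1.trans (le_add_of_nonneg_right k.cast_nonneg))
      rw [pow_succ]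
      push_cast
      rw [← add_assoc]
      linarith
  have hfloor : Tendsto (fun x : ℝ => (2 : ℝ) ^ ⌊x - a⌋₊ * m) atTop atTop :=
    ((tendsto_pow_atTop_atTop_of_one_lt one_lt_two).comp
      (tendsto_nat_floor_atTop.comp (tendsto_atTop_add_const_right _ (-a) tendsto_id))).atTop_mul_const
      hm
  refine tendsto_atTop_mono' _ ?_ hfloor
  filter_upwards [eventually_ge_atTop a] with x hx
  have h1 := Nat.floor_le (sub_nonneg.2 hx)
  have h2 := Nat.lt_floor_add_one (x - a)
  simpa using iter ⌊x - a⌋₊ (x - ⌊x - a⌋₊) ⟨by linarith, by linarith⟩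

/-- `‖Γ(x + iy)‖` grows faster than any exponential as `x → +∞` (for fixed `y ≠ 0`). -/
theorem stmt_13 (y : ℝ) (hy : y ≠ 0) (c : ℝ) :
    Filter.Tendsto (fun x : ℝ => ‖Complex.Gamma (x + Complex.I * y)‖ * Real.exp (-(c * x)))
      Filter.atTop Filter.atTop := by
  have hne : ∀ (x : ℝ) (k : ℕ), (x + Complex.I * y : ℂ) ≠ -k := fun x k h =>
    hy (by simpa using congrArg Complex.im h)
  have hcont : Continuous fun x : ℝ =>
      ‖Complex.Gamma (x + Complex.I * y)‖ * Real.exp (-(c * x)) := by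
    refine Continuous.mul (Continuous.norm ?_) (by fun_prop)
    refine continuous_iff_continuousAt.2 fun x => ?_
    exact ContinuousAt.comp (f := fun x : ℝ => (x + Complex.I * y : ℂ))
      (Complex.continuousAt_Gamma _ (hne x)) (by fun_prop)
  let a : ℝ := 2 * Real.exp c
  obtain ⟨x₀, -, hx₀⟩ := (isCompact_Icc (a := a) (b := a + 1)).exists_isMinOn
    (Set.nonempty_Icc.2 (by linarith)) hcont.continuousOn
  refine tendsto_atTop_of_two_mul_le_add_one (a := a)
    (mul_pos (norm_pos_iff.2 (Complex.Gamma_ne_zero (hne x₀))) (Real.exp_pos (-(c * x₀))))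
    (fun x hx => hx₀ hx) fun x hx => ?_
  have hrec : Complex.Gamma ((x + 1 : ℝ) + Complex.I * y) =
      (x + Complex.I * y) * Complex.Gamma (x + Complex.I * y) := by
    rw [← Complex.Gamma_add_one _ (by simpa using hne x 0)]
    push_cast
    ring_nf
  have hnorm : 2 * Real.exp c ≤ ‖(x + Complex.I * y : ℂ)‖ :=
    hx.trans (by simpa using Complex.re_le_norm (x + Complex.I * y : ℂ))
  have hexp : Real.exp (-(c * x)) = Real.exp c * Real.exp (-(c * (x + 1))) := by
    rw [← Real.exp_add]
    ring_nf
  rw [hrec, norm_mul, hexp]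
  calc 2 * (‖Complex.Gamma (x + Complex.I * y)‖ * (Real.exp c * Real.exp (-(c * (x + 1)))))
      = 2 * Real.exp c * ‖Complex.Gamma (x + Complex.I * y)‖ * Real.exp (-(c * (x + 1))) := by ring
    _ ≤ _ := by gcongr
end

section
/- For every x ∈ ℝ and every c ∈ ℝ with c < π/2, the function y ↦ exp(c·y) · ‖Γ(x + i·y)‖ tends to 0 as y → +∞. In other words, ‖Γ(x + i·y)‖ decays exponentially (at any rate below π/2) as y → +∞. -/
open Filter

/-- The Gamma function satisfies `‖Γ(1/2 + iy)‖ ≤ √(2π) exp(-πy/2)`. -/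
theorem norm_Gamma_half_add_I_mul_le (y : ℝ) :
    ‖Complex.Gamma (((1 / 2 : ℝ) : ℂ) + Complex.I * y)‖ ≤
      Real.sqrt (2 * Real.pi) * Real.exp (-(Real.pi / 2) * y) := by
  set s : ℂ := ((1 / 2 : ℝ) : ℂ) + Complex.I * y with hs
  have hconj : 1 - s = (starRingEnd ℂ) s := by
    simp only [hs, map_add, map_mul, Complex.conj_ofReal, Complex.conj_I]
    push_cast
    ring
  have hsin : Complex.sin (Real.pi * s) = (Real.cosh (Real.pi * y) : ℂ) := by
    have : (Real.pi : ℂ) * s = ((Real.pi * y : ℝ) : ℂ) * Complex.I + Real.pi / 2 := by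
      rw [hs]; push_cast; ring
    rw [this, Complex.sin_add_pi_div_two, Complex.cos_mul_I, Complex.ofReal_cosh]
  have hsq : ‖Complex.Gamma s‖ ^ 2 = Real.pi / Real.cosh (Real.pi * y) := by
    have h := congrArg norm (Complex.Gamma_mul_Gamma_one_sub s)
    rw [hconj, Complex.Gamma_conj, hsin, norm_mul, RCLike.norm_conj, norm_div,
      Complex.norm_real, Complex.norm_real, Real.norm_of_nonneg Real.pi_pos.le,
      Real.norm_of_nonneg (Real.cosh_pos _).le] at h
    rw [sq, h]
  refine le_of_sq_le_sq ?_ (by positivity)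
  rw [hsq, mul_pow, Real.sq_sqrt (by positivity), ← Real.exp_nat_mul,
    div_le_iff₀ (Real.cosh_pos _), Real.cosh_eq]
  have h1 : Real.exp (((2 : ℕ) : ℝ) * (-(Real.pi / 2) * y)) * Real.exp (Real.pi * y) = 1 := by
    rw [← Real.exp_add, Real.exp_eq_one_iff]; push_cast; ring
  have h2 : 0 ≤ Real.pi * (Real.exp (((2 : ℕ) : ℝ) * (-(Real.pi / 2) * y)) *
      Real.exp (-(Real.pi * y))) := by positivity
  linear_combination h2 - Real.pi * h1

/-- Moving to the right along the real direction costs only a constant factor, uniformly in the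
imaginary part. -/
theorem exists_norm_Gamma_le_norm_Gamma_add {x u : ℝ} (hx : 0 < x) (hu : 0 < u) :
    ∃ K : ℝ, ∀ y : ℝ, ‖Complex.Gamma (x + Complex.I * y)‖ ≤
      K * ‖Complex.Gamma (((x + u : ℝ) : ℂ) + Complex.I * y)‖ := by
  have hΓ : 0 < ‖Complex.Gamma u‖ :=
    norm_pos_iff.mpr (Complex.Gamma_ne_zero_of_re_pos (by simpa using hu))
  refine ⟨(∫ t : ℝ in 0..1, t ^ (x - 1) * ‖(1 - t : ℂ) ^ ((u : ℂ) - 1)‖) / ‖Complex.Gamma u‖,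
    fun y => ?_⟩
  have hprod := congrArg norm (Complex.Gamma_mul_Gamma_eq_betaIntegral
    (s := x + Complex.I * y) (t := u) (by simpa using hx) (by simpa using hu))
  have hbeta : ‖Complex.betaIntegral (x + Complex.I * y) u‖ ≤
      ∫ t : ℝ in 0..1, t ^ (x - 1) * ‖(1 - t : ℂ) ^ ((u : ℂ) - 1)‖ := by
    refine (intervalIntegral.norm_integral_le_integral_norm zero_le_one).trans_eq ?_
    refine intervalIntegral.integral_congr_ae (Eventually.of_forall fun t ht => ?_)
    rw [Set.uIoc_of_le zero_le_one] at ht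
    rw [norm_mul, Complex.norm_cpow_eq_rpow_re_of_pos ht.1]
    simp
  have hadd : (x : ℂ) + Complex.I * y + u = ((x + u : ℝ) : ℂ) + Complex.I * y := by
    push_cast; ring
  rw [norm_mul, norm_mul, hadd] at hprod
  rw [div_mul_eq_mul_div, le_div_iff₀ hΓ, hprod, mul_comm]
  gcongr

/-- The property that `‖Γ(x + iy)‖` decays exponentially at any rate below `π/2`. -/
def GammaDecaysAt (x : ℝ) : Prop :=
  ∀ c : ℝ, c < Real.pi / 2 →
    Tendsto (fun y : ℝ => Real.exp (c * y) * ‖Complex.Gamma (x + Complex.I * y)‖) atTop (nhds 0)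

theorem tendsto_exp_mul_atTop_nhds_zero {a : ℝ} (ha : a < 0) :
    Tendsto (fun y : ℝ => Real.exp (a * y)) atTop (nhds 0) :=
  Real.tendsto_exp_atBot.comp (tendsto_id.const_mul_atTop_of_neg ha)

theorem gammaDecaysAt_half : GammaDecaysAt (1 / 2) := by
  intro c hc
  have h : Tendsto (fun y : ℝ => Real.sqrt (2 * Real.pi) * Real.exp ((c - Real.pi / 2) * y))
      atTop (nhds 0) := by
    simpa using (tendsto_exp_mul_atTop_nhds_zero (sub_neg.mpr hc)).const_mul _
  refine squeeze_zero (fun y => by positivity) (fun y => ?_) h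
  calc _ ≤ Real.exp (c * y) * (Real.sqrt (2 * Real.pi) * Real.exp (-(Real.pi / 2) * y)) := by
        gcongr
        exact norm_Gamma_half_add_I_mul_le y
    _ = _ := by
        rw [mul_left_comm, ← Real.exp_add]
        ring_nf

theorem norm_Gamma_add_one_add_I_mul (x : ℝ) {y : ℝ} (hy : 0 < y) :
    ‖Complex.Gamma (((x + 1 : ℝ) : ℂ) + Complex.I * y)‖ =
      ‖(x : ℂ) + Complex.I * y‖ * ‖Complex.Gamma (x + Complex.I * y)‖ := by
  have hne : (x : ℂ) + Complex.I * y ≠ 0 := fun h => hy.ne' (by simpa using congrArg Complex.im h)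
  rw [← norm_mul, ← Complex.Gamma_add_one _ hne]
  push_cast
  ring_nf

theorem GammaDecaysAt.of_add_one {x : ℝ} (h : GammaDecaysAt (x + 1)) : GammaDecaysAt x := by
  intro c hc
  refine squeeze_zero' (Eventually.of_forall fun y => by positivity) ?_ (h c hc)
  filter_upwards [eventually_ge_atTop 1] with y hy
  rw [norm_Gamma_add_one_add_I_mul x (by linarith)]
  gcongr
  refine le_mul_of_one_le_left (norm_nonneg _) ?_
  have := Complex.abs_im_le_norm ((x : ℂ) + Complex.I * y)
  simp only [Complex.add_im, Complex.ofReal_im, Complex.mul_im, Complex.I_re, Complex.I_im,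
    Complex.ofReal_re, zero_mul, one_mul, zero_add] at this
  exact hy.trans ((le_abs_self y).trans this)

theorem GammaDecaysAt.add_one {x : ℝ} (h : GammaDecaysAt x) : GammaDecaysAt (x + 1) := by
  intro c hc
  obtain ⟨d, hcd, hd⟩ := exists_between hc
  have hlin : Tendsto (fun y : ℝ => (|x| + y) * Real.exp ((c - d) * y)) atTop (nhds 0) := by
    have h1 := (tendsto_exp_mul_atTop_nhds_zero (sub_neg.mpr hcd)).const_mul |x|
    have h2 : Tendsto (fun y : ℝ => y * Real.exp ((c - d) * y)) atTop (nhds 0) := by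
      simpa using tendsto_rpow_mul_exp_neg_mul_atTop_nhds_zero 1 (d - c) (sub_pos.mpr hcd)
    simpa [add_mul] using h1.add h2
  have hlim := hlin.mul (h d hd)
  rw [mul_zero] at hlim
  refine squeeze_zero' (Eventually.of_forall fun y => by positivity) ?_ hlim
  filter_upwards [eventually_gt_atTop 0] with y hy
  rw [norm_Gamma_add_one_add_I_mul x hy]
  have hexp : Real.exp (c * y) = Real.exp ((c - d) * y) * Real.exp (d * y) := by
    rw [← Real.exp_add]; ring_nf
  have hnorm : ‖(x : ℂ) + Complex.I * y‖ ≤ |x| + y := by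
    refine (norm_add_le _ _).trans_eq ?_
    simp [abs_of_pos hy]
  calc _ = ‖(x : ℂ) + Complex.I * y‖ * Real.exp ((c - d) * y) *
        (Real.exp (d * y) * ‖Complex.Gamma (x + Complex.I * y)‖) := by rw [hexp]; ring
    _ ≤ _ := by gcongr

theorem GammaDecaysAt.of_lt {x z : ℝ} (hx : 0 < x) (hxz : x < z) (h : GammaDecaysAt z) :
    GammaDecaysAt x := by
  intro c hc
  obtain ⟨K, hK⟩ := exists_norm_Gamma_le_norm_Gamma_add hx (sub_pos.mpr hxz)
  rw [add_sub_cancel] at hK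
  have hlim := (h c hc).const_mul K
  rw [mul_zero] at hlim
  refine squeeze_zero (fun y => by positivity) (fun y => ?_) hlim
  rw [mul_left_comm]
  gcongr
  exact hK y

theorem gammaDecaysAt_half_add_natCast (n : ℕ) : GammaDecaysAt (1 / 2 + n) := by
  induction n with
  | zero => simpa using gammaDecaysAt_half
  | succ n ih => simpa [add_assoc] using ih.add_one

theorem gammaDecaysAt_of_pos {x : ℝ} (hx : 0 < x) : GammaDecaysAt x := by
  obtain ⟨n, hn⟩ := exists_nat_gt x
  exact (gammaDecaysAt_half_add_natCast n).of_lt hx (by linarith)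

theorem GammaDecaysAt.of_add_natCast {x : ℝ} (n : ℕ) (h : GammaDecaysAt (x + n)) :
    GammaDecaysAt x := by
  induction n with
  | zero => simpa using h
  | succ n ih => exact ih (GammaDecaysAt.of_add_one (by simpa [add_assoc] using h))

theorem gammaDecaysAt (x : ℝ) : GammaDecaysAt x := by
  obtain ⟨n, hn⟩ := exists_nat_gt (-x)
  exact (gammaDecaysAt_of_pos (by linarith)).of_add_natCast n

/-- `‖Γ(x + iy)‖` decays exponentially at any rate below `π/2` as `y → +∞` (for fixed `x`). -/
theorem stmt_14 (x : ℝ) (c : ℝ) (hc : c < Real.pi / 2) :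
    Filter.Tendsto (fun y : ℝ => Real.exp (c * y) * ‖Complex.Gamma (x + Complex.I * y)‖)
      Filter.atTop (nhds 0) :=
  gammaDecaysAt x c hc
end
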